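/- arXiv:2412.07047 — 2 statements merged into one kernel-verified Lean document; each statement's English description precedes it below -/
import Mathlib

section
/- Let (X, μ, E) be a properly ergodic mcp CBER of type III and let A, B ⊆ X be non-null Borel sets. Then there exists an element φ of the full pseudogroup [[E]] with domain A and image B (up to μ-null sets): a Borel bijection φ : A → B with (x, φ(x)) ∈ E for almost every x ∈ A. -/
open MeasureTheory Set Filter
open scoped ENNReal ENat Topology

noncomputable section

variable {X : Type*}

/-- The integral of `f` over the set of edges `A` against the "left" measure `ν_l`
determined by `μ`:  `∫ₐ f dν_l = ∫ₓ Σ_{y : (x,y) ∈ A} f(x,y) dμ(x)`. -/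
def lintL [MeasurableSpace X] (μ : Measure X) (f : X × X → ℝ≥0∞) (A : Set (X × X)) : ℝ≥0∞ :=
  ∫⁻ x, ∑' y : {y : X // (x, y) ∈ A}, f (x, (y : X)) ∂μ

/-- The integral of `f` over the set of edges `A` against the "right" measure `ν_r`
determined by `μ`:  `∫ₐ f dν_r = ∫ₓ Σ_{y : (y,x) ∈ A} f(y,x) dμ(x)`. -/
def lintR [MeasurableSpace X] (μ : Measure X) (f : X × X → ℝ≥0∞) (A : Set (X × X)) : ℝ≥0∞ :=
  ∫⁻ x, ∑' y : {y : X // (y, x) ∈ A}, f ((y : X), x) ∂μ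

/-- `ν_l(A) = ∫ₓ |{y : (x,y) ∈ A}| dμ(x)`. -/
def nuL [MeasurableSpace X] (μ : Measure X) (A : Set (X × X)) : ℝ≥0∞ :=
  lintL μ (fun _ => 1) A

/-- `ν_r(A) = ∫ₓ |{y : (y,x) ∈ A}| dμ(x)`. -/
def nuR [MeasurableSpace X] (μ : Measure X) (A : Set (X × X)) : ℝ≥0∞ :=
  lintR μ (fun _ => 1) A

/-- `E` is measure-class-preserving w.r.t. `μ`: `ν_l` and `ν_r` are mutually absolutely
continuous on Borel subsets of `E`. -/
def MCP [MeasurableSpace X] (μ : Measure X) (E : Set (X × X)) : Prop :=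
  ∀ A : Set (X × X), A ⊆ E → MeasurableSet A → (nuL μ A = 0 ↔ nuR μ A = 0)

/-- `E` is measure-preserving w.r.t. `μ`: `ν_l = ν_r` on Borel subsets of `E`. -/
def MPrel [MeasurableSpace X] (μ : Measure X) (E : Set (X × X)) : Prop :=
  ∀ A : Set (X × X), A ⊆ E → MeasurableSet A → nuL μ A = nuR μ A

/-- A countable Borel equivalence relation: a Borel equivalence relation all of whose
classes are countable. -/
def IsCBER [MeasurableSpace X] (E : Set (X × X)) : Prop :=
  MeasurableSet E ∧ Equivalence (fun x y => (x, y) ∈ E) ∧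
    ∀ x : X, {y | (x, y) ∈ E}.Countable

/-- The `E`-saturation of a set `A`. -/
def ESat (E : Set (X × X)) (A : Set X) : Set X :=
  {x | ∃ y ∈ A, (x, y) ∈ E}

/-- `E` is ergodic w.r.t. `μ`: every non-null Borel set is a complete section. -/
def ErgodicRel [MeasurableSpace X] (μ : Measure X) (E : Set (X × X)) : Prop :=
  ∀ A : Set X, MeasurableSet A → μ A ≠ 0 → μ (ESat E A)ᶜ = 0

/-- `E` is properly ergodic: ergodic, and `μ` is not concentrated on a single `E`-class. -/
def ProperlyErgodicRel [MeasurableSpace X] (μ : Measure X) (E : Set (X × X)) : Prop :=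
  ErgodicRel μ E ∧ ∀ x : X, μ {y | (x, y) ∉ E} ≠ 0

/-- `μ'` is `E`-invariant: every Borel bijection between Borel subsets whose graph is
contained in `E` pushes the restricted measure forward to the restricted measure. -/
def InvariantUnder [MeasurableSpace X] (μ' : Measure X) (E : Set (X × X)) : Prop :=
  ∀ (f : X → X) (A : Set X), Measurable f → MeasurableSet A → Set.InjOn f A →
    (∀ x ∈ A, (x, f x) ∈ E) →
    Measure.map f (μ'.restrict A) = μ'.restrict (f '' A)

/-- Mutual absolute continuity of measures. -/
def EquivMeasure [MeasurableSpace X] (μ' μ : Measure X) : Prop :=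
  μ' ≪ μ ∧ μ ≪ μ'

/-- Type II: `μ` is non-atomic and some σ-finite measure equivalent to `μ` is `E`-invariant. -/
def IsTypeII [MeasurableSpace X] (μ : Measure X) (E : Set (X × X)) : Prop :=
  NoAtoms μ ∧
    ∃ μ' : Measure X, SigmaFinite μ' ∧ EquivMeasure μ' μ ∧ InvariantUnder μ' E

/-- Type III: no σ-finite measure equivalent to `μ` is `E`-invariant. -/
def IsTypeIII [MeasurableSpace X] (μ : Measure X) (E : Set (X × X)) : Prop :=
  ¬ ∃ μ' : Measure X, SigmaFinite μ' ∧ EquivMeasure μ' μ ∧ InvariantUnder μ' E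

/-- `w` is (a pointwise-cocycle version of) the Radon–Nikodym cocycle `𝔴 = dν_l/dν_r` of the
mcp relation `E`: it is Borel, takes values in `(0,∞)` on `E`, satisfies the cocycle identity,
and `ν_l(A) = ∫_A w dν_r` for every Borel `A ⊆ E`. -/
def IsRNCocycle [MeasurableSpace X] (μ : Measure X) (E : Set (X × X))
    (w : X × X → ℝ≥0∞) : Prop :=
  Measurable w ∧
  (∀ e ∈ E, w e ≠ 0 ∧ w e ≠ ∞) ∧
  (∀ x y z : X, (y, x) ∈ E → (z, y) ∈ E → w (z, y) * w (y, x) = w (z, x)) ∧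
  (∀ x : X, w (x, x) = 1) ∧
  ∀ A : Set (X × X), A ⊆ E → MeasurableSet A → nuL μ A = lintR μ w A

/-- The connectedness relation of a graph `G`: `x` and `y` are related iff they are joined
by a path of edges of `G`. -/
def connRel (G : Set (X × X)) : Set (X × X) :=
  {p | Relation.ReflTransGen (fun a b => (a, b) ∈ G) p.1 p.2}

/-- The symmetrization of a directed graph. -/
def symmCl (G : Set (X × X)) : Set (X × X) :=
  {p | p ∈ G ∨ (p.2, p.1) ∈ G}

/-- The graph distance in `G` (with value `⊤` between distinct components). -/
def gdist (G : Set (X × X)) (x y : X) : ℕ∞ :=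
  sInf ((fun m : ℕ => (m : ℕ∞)) ''
    {m : ℕ | ∃ c : ℕ → X, c 0 = x ∧ c m = y ∧ ∀ i < m, (c i, c (i + 1)) ∈ G})

/-- For a directed edge `(x,y)` of an acyclic graph `G`, the half-space
`N_{(x,y)} = {z : d_G(y,z) < d_G(x,z)}`. -/
def halfSpace (G : Set (X × X)) (x y : X) : Set X :=
  {z | gdist G y z < gdist G x z}

/-- A geodesic ray in `G`. -/
def IsGeodesicRay (G : Set (X × X)) (r : ℕ → X) : Prop :=
  (∀ i : ℕ, (r i, r (i + 1)) ∈ G) ∧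
    ∀ i j : ℕ, i ≤ j → gdist G (r i) (r j) = ((j - i : ℕ) : ℕ∞)

/-- The end represented by the geodesic ray `r` is vanishing w.r.t. the cocycle `w`:
`sup {w(y, r 0) : y ∈ N_{(r i, r (i+1))}} → 0` as `i → ∞`. -/
def VanishingEnd (w : X × X → ℝ≥0∞) (G : Set (X × X)) (r : ℕ → X) : Prop :=
  Tendsto (fun i : ℕ => ⨆ y ∈ halfSpace G (r i) (r (i + 1)), w (y, r 0))
    atTop (nhds 0)

/-- A (symmetric) graph is acyclic if it has no injective cycle of length `≥ 3`. -/
def AcyclicGraph (G : Set (X × X)) : Prop :=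
  ∀ (n : ℕ) (c : ℕ → X), 2 < n → (∀ i < n, (c i, c ((i + 1) % n)) ∈ G) →
    ¬ Function.Injective fun i : Fin n => c (i : ℕ)

/-- Amenability of a locally countable Borel graph `G` (w.r.t. the measure `μ`):
there are Borel a.e.-averaging functions `λ_n` on the connectedness relation of `G`. -/
def AmenableGraph [MeasurableSpace X] (μ : Measure X) (G : Set (X × X)) : Prop :=
  ∃ lam : ℕ → X × X → ℝ,
    (∀ n, Measurable (lam n)) ∧
    (∀ n e, 0 ≤ lam n e) ∧
    (∀ᵐ x ∂μ, ∀ n : ℕ, ∑' y : {y : X // (x, y) ∈ connRel G}, lam n (x, (y : X)) = 1) ∧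
    nuL μ {e ∈ G | ¬ Tendsto
        (fun n : ℕ => ∑' z : {z : X // (e.1, z) ∈ connRel G},
          |lam n (e.1, (z : X)) - lam n (e.2, (z : X))|)
        atTop (nhds 0)} = 0

/-- The Schreier graph of an action of a free group, with respect to the free basis. -/
def schreier {ι : Type*} [MeasurableSpace X] (φ : FreeGroup ι →* Equiv.Perm X) :
    Set (X × X) :=
  {p | p.1 ≠ p.2 ∧ ∃ s : ι,
    φ (FreeGroup.of s) p.1 = p.2 ∨ φ (FreeGroup.of s) p.2 = p.1}


lemma aux_step {X : Type*} [MeasurableSpace X] (μ : Measure X) (f : (ℕ → ℕ) → X) (T : Set (ℕ → ℕ))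
    (c : ℝ≥0∞) (h : c < μ (f '' T)) (k : ℕ) : ∃ m : ℕ, c < μ (f '' (T ∩ {s | s k ≤ m})) := by
  have hm : Monotone fun m : ℕ => f '' (T ∩ {s | s k ≤ m}) := by
    intro a b hab
    apply image_mono
    apply inter_subset_inter_right
    intro s hs
    exact le_trans hs hab
  have hu : f '' T = ⋃ m : ℕ, f '' (T ∩ {s | s k ≤ m}) := by
    rw [← image_iUnion]
    congr 1
    ext s
    simp only [mem_iUnion, mem_inter_iff, mem_ofPred_eq]
    exact ⟨fun hs => ⟨s k, hs, le_rfl⟩, fun ⟨_, hs, _⟩ => hs⟩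
  rw [hu, hm.measure_iUnion] at h
  exact lt_iSup_iff.1 h

lemma analytic_inner {X : Type*} [TopologicalSpace X] [PolishSpace X] [MeasurableSpace X]
    [BorelSpace X] (μ : Measure X) [IsFiniteMeasure μ] (A : Set X) (hA : AnalyticSet A)
    (c : ℝ≥0∞) (hc : c < μ A) : ∃ K ⊆ A, MeasurableSet K ∧ c ≤ μ K := by
  rw [AnalyticSet] at hA
  rcases hA with rfl | ⟨f, hf, rfl⟩
  · simp at hc
  rw [← image_univ] at hc
  choose m hm using fun (T : {T : Set (ℕ → ℕ) // c < μ (f '' T)}) k =>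
    aux_step μ f T.1 c T.2 k
  let T : ℕ → {T : Set (ℕ → ℕ) // c < μ (f '' T)} := fun k =>
    Nat.rec ⟨univ, hc⟩ (fun k T => ⟨T.1 ∩ {s | s k ≤ m T k}, hm T k⟩) k
  let n : ℕ → ℕ := fun k => m (T k) k
  have hT : ∀ k s, s ∈ (T k).1 → ∀ i < k, s i ≤ n i := by
    intro k
    induction k with
    | zero => intro s _ i hi; omega
    | succ k ih =>
      intro s hs i hi
      have hs' : s ∈ (T k).1 ∩ {s | s k ≤ n k} := hs
      rcases Nat.lt_succ_iff_lt_or_eq.1 hi with h | rfl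
      · exact ih s hs'.1 i h
      · exact hs'.2
  let K : Set (ℕ → ℕ) := Set.pi univ fun i => Set.Iic (n i)
  have hK : IsCompact K := isCompact_univ_pi fun i => (Set.finite_Iic _).isCompact
  refine ⟨f '' K, image_subset_range _ _, (hK.image hf).isClosed.measurableSet, ?_⟩
  rw [Set.measure_eq_iInf_isOpen]
  refine le_iInf₂ fun U hU => le_iInf fun hUo => ?_
  by_contra hlt
  push Not at hlt
  have hex : ∀ k, ∃ s ∈ (T k).1, f s ∉ U := by
    intro k
    by_contra hh
    push Not at hh
    have : f '' (T k).1 ⊆ U := by rintro _ ⟨s, hs, rfl⟩; exact hh s hs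
    exact absurd ((T k).2.trans_le (measure_mono this)) (not_lt.2 hlt.le)
  choose s hsT hsU using hex
  obtain ⟨t, htK, φ, hφ, hlim⟩ := hK.tendsto_subseq (x := fun k i => min (s k i) (n i))
    (fun k i _ => mem_Iic.2 (min_le_right _ _))
  have hlim2 : Tendsto (s ∘ φ) atTop (𝓝 t) := by
    rw [tendsto_pi_nhds] at hlim ⊢
    intro i
    refine (hlim i).congr' ?_
    filter_upwards [eventually_gt_atTop i] with j hj
    have := hT _ _ (hsT (φ j)) i (hj.trans_le (hφ.id_le j))
    simp [this]
  have := (hf.tendsto t).comp hlim2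
  obtain ⟨j, hj⟩ := (this.eventually (hUo.mem_nhds (hU ⟨t, htK, rfl⟩))).exists
  exact hsU _ hj

lemma analytic_nullMeas {X : Type*} [TopologicalSpace X] [PolishSpace X] [MeasurableSpace X]
    [BorelSpace X] (μ : Measure X) [IsFiniteMeasure μ] (A : Set X) (hA : AnalyticSet A) :
    NullMeasurableSet A μ := by
  by_cases h0 : μ A = 0
  · exact NullMeasurableSet.of_null h0
  obtain ⟨u, -, hu, hlim⟩ := exists_seq_strictMono_tendsto' (pos_iff_ne_zero.2 h0)
  choose K hKA hKm hK using fun n => analytic_inner μ A hA (u n) (hu n).2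
  have hsub : (⋃ n, K n) ⊆ A := iUnion_subset hKA
  have hle : μ A ≤ μ (⋃ n, K n) :=
    le_of_tendsto' hlim fun n => (hK n).trans (measure_mono (subset_iUnion K n))
  have hM : MeasurableSet (⋃ n, K n) := MeasurableSet.iUnion hKm
  have h1 : (⋃ n, K n) =ᵐ[μ] toMeasurable μ A :=
    ae_eq_of_subset_of_measure_ge (hsub.trans (subset_toMeasurable _ _))
      (by rw [measure_toMeasurable]; exact hle) hM.nullMeasurableSet (measure_ne_top _ _)
  have h2 : A =ᵐ[μ] ⋃ n, K n :=
    Filter.EventuallyLE.antisymm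
      ((LE.le.eventuallyLE (subset_toMeasurable μ A)).trans h1.symm.le)
      (LE.le.eventuallyLE hsub)
  exact hM.nullMeasurableSet.congr h2.symm

lemma image_nullMeas {Z X : Type*} [MeasurableSpace Z] [StandardBorelSpace Z] [MeasurableSpace X]
    [StandardBorelSpace X] (μ : Measure X) [IsFiniteMeasure μ] {p : Z → X} (hp : Measurable p)
    {S : Set Z} (hS : MeasurableSet S) : NullMeasurableSet (p '' S) μ := by
  let := upgradeStandardBorel X
  exact analytic_nullMeas μ _ (hS.analyticSet_image hp)


def GoodK {Z X : Type*} [TopologicalSpace Z] [MeasurableSpace Z] (p : Z → X) (K : Set Z) : Prop :=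
  MeasurableSet K ∧ (∀ x, IsClosed (K ∩ p ⁻¹' {x})) ∧
    ∃ G : Set (Set Z), G.Countable ∧ (∀ g ∈ G, MeasurableSet g ∧ InjOn p g) ∧ Kᶜ ⊆ ⋃₀ G

lemma GoodK.iInter {Z X ι : Type*} [TopologicalSpace Z] [MeasurableSpace Z] [Countable ι]
    [Nonempty ι] {p : Z → X} {K : ι → Set Z} (h : ∀ i, GoodK p (K i)) : GoodK p (⋂ i, K i) := by
  refine ⟨MeasurableSet.iInter fun i => (h i).1, fun x => ?_, ?_⟩
  · rw [iInter_inter]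
    exact isClosed_iInter fun i => (h i).2.1 x
  · choose G hGc hG hcov using fun i => (h i).2.2
    refine ⟨⋃ i, G i, countable_iUnion hGc, ?_, ?_⟩
    · intro g hg
      obtain ⟨i, hi⟩ := mem_iUnion.1 hg
      exact hG i g hi
    · rw [compl_iInter]
      refine iUnion_subset fun i => (hcov i).trans ?_
      exact sUnion_subset_sUnion (subset_iUnion G i)

lemma exists_min {Z X : Type*} [TopologicalSpace Z] [MeasurableSpace Z] 
    (p : Z → X) (Φ : Set Z → ℝ≥0∞) (hΦ : Monotone Φ) (hne : GoodK p univ) :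
    ∃ K, GoodK p K ∧ ∀ K', GoodK p K' → Φ K ≤ Φ K' := by
  obtain ⟨u, -, hlim, hu⟩ := exists_seq_tendsto_sInf (S := Φ '' {K | GoodK p K}) ⟨_, univ, hne, rfl⟩
    (OrderBot.bddBelow _)
  choose K hK hKu using hu
  refine ⟨⋂ n, K n, GoodK.iInter hK, fun K' hK' => ?_⟩
  have h1 : Φ (⋂ n, K n) ≤ sInf (Φ '' {K | GoodK p K}) :=
    ge_of_tendsto' hlim fun n => by rw [← hKu]; exact hΦ (iInter_subset K n)
  exact h1.trans (sInf_le ⟨K', hK', rfl⟩)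

lemma LN_top {Z X : Type*} [TopologicalSpace Z] [PolishSpace Z] [MeasurableSpace Z] [BorelSpace Z]
    [TopologicalSpace X] [PolishSpace X] [MeasurableSpace X] [BorelSpace X]
    (μ : Measure X) [IsFiniteMeasure μ] (p : Z → X) (hp : Continuous p)
    (hc : ∀ x, (p ⁻¹' {x}).Countable) :
    ∃ G : Set (Set Z), G.Countable ∧ (∀ g ∈ G, MeasurableSet g ∧ InjOn p g) ∧
      μ (p '' (⋃₀ G)ᶜ) = 0 := by
  have huniv : GoodK p univ := by
    refine ⟨MeasurableSet.univ, fun x => ?_, ∅, countable_empty, by simp, by simp⟩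
    rw [univ_inter]
    exact isClosed_singleton.preimage hp
  obtain ⟨b, hbc, -, hb⟩ := TopologicalSpace.exists_countable_basis Z
  have : Countable b := hbc.to_subtype
  choose K hK hmin using fun U : b => exists_min p (fun K => μ (p '' (K ∩ U)))
    (fun K K' h => measure_mono (image_mono (inter_subset_inter_left _ h))) huniv
  let L : Set Z := ⋂ U : Option b, U.elim univ K
  have hL : GoodK p L := GoodK.iInter fun U => by cases U <;> simp [huniv, hK]
  have hLmin : ∀ U ∈ b, ∀ K', GoodK p K' → μ (p '' (L ∩ U)) ≤ μ (p '' (K' ∩ U)) := by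
    intro U hU K' hK'
    refine le_trans (measure_mono (image_mono (inter_subset_inter_left _ ?_))) (hmin ⟨U, hU⟩ K' hK')
    exact iInter_subset (fun U : Option b => U.elim univ K) (some ⟨U, hU⟩)
  let P : Set Z → Set X := fun U => 
    (fun q : Z × Z => p q.1) '' {q | q.1 ∈ L ∩ U ∧ q.2 ∈ L ∩ U ∧ p q.1 = p q.2 ∧ q.1 ≠ q.2}
  let D : Set Z → Set X := fun U => p '' (L ∩ U) \ P U
  have hD0 : ∀ U ∈ b, μ (D U) = 0 := by
    intro U hU
    by_contra hne
    have hUm : MeasurableSet U := (hb.isOpen hU).measurableSet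
    have hLU : MeasurableSet (L ∩ U) := hL.1.inter hUm
    have hPn : NullMeasurableSet (P U) μ := by
      apply image_nullMeas μ (hp.measurable.comp measurable_fst)
      refine (measurable_fst hLU).inter ((measurable_snd hLU).inter (MeasurableSet.inter ?_ ?_))
      · exact measurableSet_eq_fun (hp.measurable.comp measurable_fst)
          (hp.measurable.comp measurable_snd)
      · exact (measurableSet_eq_fun measurable_fst measurable_snd).compl
    have hDn : NullMeasurableSet (D U) μ := (image_nullMeas μ hp.measurable hLU).diff hPn
    obtain ⟨D', hD', hD'm, hD'e⟩ := hDn.exists_measurable_subset_ae_eq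
    have hinj : InjOn p (L ∩ U ∩ p ⁻¹' D') := by
      rintro z ⟨hz, hzD⟩ z' ⟨hz', -⟩ he
      by_contra hne
      exact (hD' hzD).2 ⟨(z, z'), ⟨hz, hz', he, hne⟩, rfl⟩
    have hK' : GoodK p (L \ (U ∩ p ⁻¹' D')) := by
      refine ⟨hL.1.diff (hUm.inter (hp.measurable hD'm)), fun x => ?_, ?_⟩
      · by_cases hx : x ∈ D'
        · have : L \ (U ∩ p ⁻¹' D') ∩ p ⁻¹' {x} = (L ∩ p ⁻¹' {x}) ∩ Uᶜ := by
            ext z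
            simp only [mem_inter_iff, Set.mem_sdiff, mem_preimage, mem_singleton_iff, mem_compl_iff]
            constructor
            · rintro ⟨⟨h1, h2⟩, rfl⟩; exact ⟨⟨h1, rfl⟩, fun h => h2 ⟨h, hx⟩⟩
            · rintro ⟨⟨h1, rfl⟩, h2⟩; exact ⟨⟨h1, fun h => h2 h.1⟩, rfl⟩
          rw [this]
          exact (hL.2.1 x).inter (hb.isOpen hU).isClosed_compl
        · have : L \ (U ∩ p ⁻¹' D') ∩ p ⁻¹' {x} = (L ∩ p ⁻¹' {x}) := by
            ext z
            simp only [mem_inter_iff, Set.mem_sdiff, mem_preimage, mem_singleton_iff]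
            constructor
            · rintro ⟨⟨h1, h2⟩, rfl⟩; exact ⟨h1, rfl⟩
            · rintro ⟨h1, rfl⟩; exact ⟨⟨h1, fun h => hx h.2⟩, rfl⟩
          rw [this]
          exact hL.2.1 x
      · obtain ⟨G, hGc, hG, hcov⟩ := hL.2.2
        refine ⟨insert (L ∩ U ∩ p ⁻¹' D') G, hGc.insert _, ?_, ?_⟩
        · rintro g (rfl | hg)
          · exact ⟨hLU.inter (hp.measurable hD'm), hinj⟩
          · exact hG g hg
        · intro z hz
          by_cases hzL : z ∈ L
          · refine ⟨_, mem_insert _ _, ⟨hzL, ?_⟩, ?_⟩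
            · by_contra h; exact hz ⟨hzL, fun h' => h h'.1⟩
            · by_contra h; exact hz ⟨hzL, fun h' => h h'.2⟩
          · obtain ⟨g, hg, hzg⟩ := hcov hzL
            exact ⟨g, mem_insert_of_mem _ hg, hzg⟩
    have hle := hLmin U hU _ hK'
    have hsub : p '' ((L \ (U ∩ p ⁻¹' D')) ∩ U) ⊆ p '' (L ∩ U) \ D' := by
      rintro _ ⟨z, ⟨⟨hzL, hz⟩, hzU⟩, rfl⟩
      exact ⟨⟨z, ⟨hzL, hzU⟩, rfl⟩, fun h => hz ⟨hzU, h⟩⟩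
    have hle2 := hle.trans (measure_mono hsub)
    rw [measure_sdiff (hD'.trans sdiff_subset) hD'm.nullMeasurableSet (measure_ne_top _ _)] at hle2
    have hpos : μ D' ≠ 0 := by rw [measure_congr hD'e]; exact hne
    have hp0 : μ (p '' (L ∩ U)) ≠ 0 := fun h => hpos
      (measure_mono_null (hD'.trans sdiff_subset) h)
    exact absurd hle2 (not_le.2 (ENNReal.sub_lt_self (measure_ne_top _ _) hp0 hpos))
  obtain ⟨G, hGc, hG, hcov⟩ := hL.2.2
  refine ⟨G, hGc, hG, measure_mono_null ?_ ((measure_biUnion_null_iff hbc).2 hD0)⟩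
  have hsub : (⋃₀ G)ᶜ ⊆ L := by
    rw [compl_subset_comm]; exact hcov
  refine (image_mono hsub).trans ?_
  rintro _ ⟨z, hz, rfl⟩
  by_contra hN
  simp only [mem_iUnion, not_exists] at hN
  have hperf : Perfect (L ∩ p ⁻¹' {p z}) := by
    refine ⟨hL.2.1 _, ?_⟩
    rw [preperfect_iff_nhds]
    rintro w ⟨hwL, hwp⟩ V hV
    obtain ⟨U, hU, hwU, hUV⟩ := hb.mem_nhds_iff.1 hV
    have h1 : p w = p z := hwp
    have h2 := hN U hU
    rw [← h1] at h2
    have h3 : p w ∈ P U := by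
      by_contra h; exact h2 ⟨⟨w, ⟨hwL, hwU⟩, rfl⟩, h⟩
    obtain ⟨⟨a, c⟩, ⟨ha, hc, hac, hne⟩, haw⟩ := h3
    simp only at ha hc hac hne haw
    by_cases hw : a = w
    · subst hw
      exact ⟨c, ⟨hUV hc.2, hc.1, by rw [mem_preimage, ← hac]; exact hwp⟩, hne.symm⟩
    · exact ⟨a, ⟨hUV ha.2, ha.1, by rw [mem_preimage, haw]; exact hwp⟩, hw⟩
  let := TopologicalSpace.upgradeIsCompletelyMetrizable Z
  obtain ⟨f, hf, -, hfi⟩ := hperf.exists_nat_bool_injection ⟨z, hz, rfl⟩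
  have hcr : (range f).Countable := (hc (p z)).mono (hf.trans inter_subset_right)
  have : Countable (ℕ → Bool) := by
    rw [← image_univ] at hcr
    exact countable_univ_iff.1 ((countable_of_injective_of_countable_image hfi.injOn) hcr)
  obtain ⟨g, hg⟩ := exists_surjective_nat (ℕ → Bool)
  obtain ⟨n, hn⟩ := hg (fun n => !g n n)
  have h4 := congrFun hn n
  simp at h4

lemma LN {Z X : Type*} [MeasurableSpace Z] [StandardBorelSpace Z]
    [MeasurableSpace X] [StandardBorelSpace X]
    (μ : Measure X) [IsFiniteMeasure μ] (p : Z → X) (hp : Measurable p)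
    (hc : ∀ x, (p ⁻¹' {x}).Countable) :
    ∃ G : Set (Set Z), G.Countable ∧ (∀ g ∈ G, MeasurableSet g ∧ InjOn p g) ∧
      μ (p '' (⋃₀ G)ᶜ) = 0 := by
  let := upgradeStandardBorel X
  let tZ := upgradeStandardBorel Z
  have hpZ : @PolishSpace Z tZ.toTopologicalSpace := inferInstance
  have hbZ : @BorelSpace Z tZ.toTopologicalSpace _ := inferInstance
  obtain ⟨t', hle, hcont, hpol⟩ := hp.exists_continuous
  have hb : @BorelSpace Z t' _ := by
    constructor
    rw [borel_eq_borel_of_le hpol hpZ hle]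
    exact hbZ.measurable_eq
  exact @LN_top Z X t' hpol _ hb _ _ _ _ μ _ p hcont hc


lemma measurable_of_graph {X Y : Type*} [MeasurableSpace X] [StandardBorelSpace X]
    [MeasurableSpace Y] [StandardBorelSpace Y] (g : X → Y)
    (h : MeasurableSet {q : X × Y | g q.1 = q.2}) : Measurable g := by
  intro S hS
  have : g ⁻¹' S = Prod.fst '' ({q : X × Y | g q.1 = q.2} ∩ Prod.snd ⁻¹' S) := by
    ext x
    constructor
    · intro hx; exact ⟨(x, g x), ⟨rfl, hx⟩, rfl⟩
    · rintro ⟨⟨a, b⟩, ⟨h1, h2⟩, rfl⟩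
      have h1' : g a = b := h1
      subst h1'
      exact h2
  rw [this]
  refine (h.inter (measurable_snd hS)).image_of_measurable_injOn measurable_fst ?_
  rintro ⟨a, b⟩ ⟨h1, -⟩ ⟨c, d⟩ ⟨h2, -⟩ he
  have h1' : g a = b := h1
  have h2' : g c = d := h2
  have he' : a = c := he
  subst h1' h2' he'
  rfl

lemma exists_involution {X : Type*} [MeasurableSpace X] [StandardBorelSpace X]
    (H : Set (X × X)) (hH : MeasurableSet H) (h1 : InjOn Prod.fst H) (h2 : InjOn Prod.snd H)
    (U : Set X) (hU1 : ∀ x y, (x, y) ∈ H → x ∈ U) (hU2 : ∀ x y, (x, y) ∈ H → y ∉ U) :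
    ∃ g : X ≃ᵐ X, g.symm = g ∧ (∀ x, g x = x ∨ (x, g x) ∈ H ∨ (g x, x) ∈ H) ∧
      ∀ x y, (x, y) ∈ H → g x = y := by
  classical
  let g : X → X := fun x => if h : ∃ y, (x, y) ∈ H then h.choose else
    if h : ∃ y, (y, x) ∈ H then h.choose else x
  have ga : ∀ x y, (x, y) ∈ H → g x = y := by
    intro x y hxy
    have h : ∃ y, (x, y) ∈ H := ⟨y, hxy⟩
    have e : g x = h.choose := dif_pos h
    rw [e]
    exact congrArg Prod.snd (h1 h.choose_spec hxy rfl)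
  have gb : ∀ x y, (y, x) ∈ H → g x = y := by
    intro x y hxy
    have hn : ¬ ∃ y, (x, y) ∈ H := fun ⟨z, hz⟩ => hU2 _ _ hxy (hU1 _ _ hz)
    have h : ∃ y, (y, x) ∈ H := ⟨y, hxy⟩
    have e : g x = h.choose := (dif_neg hn).trans (dif_pos h)
    rw [e]
    exact congrArg Prod.fst (h2 h.choose_spec hxy rfl)
  have gc : ∀ x, (¬ ∃ y, (x, y) ∈ H) → (¬ ∃ y, (y, x) ∈ H) → g x = x := by
    intro x hx hx'
    exact (dif_neg hx).trans (dif_neg hx')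
  have gall : ∀ x, (g x = x ∧ (¬ ∃ y, (x, y) ∈ H) ∧ (¬ ∃ y, (y, x) ∈ H)) ∨ 
      (x, g x) ∈ H ∨ (g x, x) ∈ H := by
    intro x
    by_cases hx : ∃ y, (x, y) ∈ H
    · obtain ⟨y, hy⟩ := hx
      right; left; rw [ga x y hy]; exact hy
    by_cases hx' : ∃ y, (y, x) ∈ H
    · obtain ⟨y, hy⟩ := hx'
      right; right; rw [gb x y hy]; exact hy
    · exact Or.inl ⟨gc x hx hx', hx, hx'⟩
  have ginv : Function.Involutive g := by
    intro x
    rcases gall x with h | h | h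
    · rw [h.1, h.1]
    · exact gb _ _ h
    · exact ga _ _ h
  have gm : Measurable g := by
    apply measurable_of_graph
    have : {q : X × X | g q.1 = q.2} = H ∪ (Prod.swap ⁻¹' H) ∪
        ({q | q.1 = q.2} ∩ Prod.fst ⁻¹' (Prod.fst '' H ∪ Prod.snd '' H)ᶜ) := by
      ext ⟨x, y⟩
      constructor
      · intro h
        have h' : g x = y := h
        subst h'
        rcases gall x with h | h | h
        · right
          refine ⟨h.1.symm, ?_⟩
          rintro (⟨⟨a, b⟩, hab, rfl⟩ | ⟨⟨a, b⟩, hab, rfl⟩)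
          · exact h.2.1 ⟨b, hab⟩
          · exact h.2.2 ⟨a, hab⟩
        · exact Or.inl (Or.inl h)
        · exact Or.inl (Or.inr h)
      · rintro ((h | h) | ⟨h, h'⟩)
        · exact ga _ _ h
        · exact gb _ _ h
        · have e : x = y := h
          subst e
          refine gc x ?_ ?_
          · rintro ⟨z, hz⟩; exact h' (Or.inl ⟨_, hz, rfl⟩)
          · rintro ⟨z, hz⟩; exact h' (Or.inr ⟨_, hz, rfl⟩)
    rw [this]
    refine (hH.union (measurable_swap hH)).union
      ((measurableSet_eq_fun measurable_fst measurable_snd).inter (measurable_fst ?_))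
    exact ((hH.image_of_measurable_injOn measurable_fst h1).union
      (hH.image_of_measurable_injOn measurable_snd h2)).compl
  refine ⟨⟨ginv.toPerm, gm, gm⟩, ?_, ?_, ga⟩
  · ext x; rfl
  · intro x
    rcases gall x with h | h
    · exact Or.inl h.1
    · exact Or.inr h

lemma closure_words {X ι : Type*} [MeasurableSpace X] [Countable ι] (E : Set (X × X))
    (hE : Equivalence (fun x y => (x, y) ∈ E)) (g : ι → X ≃ᵐ X) (hs : ∀ i, (g i).symm = g i)
    (hg : ∀ i x, (x, g i x) ∈ E) :
    ∃ G : ℕ → X ≃ᵐ X, (∀ n x, (x, G n x) ∈ E) ∧ (∀ i, ∃ n, G n = g i) ∧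
      (∀ m n, ∃ k, G k = (G m).trans (G n)) ∧ (∀ n, ∃ k, G k = (G n).symm) ∧
      (∃ k, G k = MeasurableEquiv.refl X) := by
  let w : List ι → X ≃ᵐ X := fun l => l.foldr (fun i e => (g i).trans e) (MeasurableEquiv.refl X)
  have wapp : ∀ a b, w (a ++ b) = (w a).trans (w b) := by
    intro a b
    induction a with
    | nil => rfl
    | cons i a ih =>
      have e1 : w (i :: a ++ b) = (g i).trans (w (a ++ b)) := rfl
      have e2 : w (i :: a) = (g i).trans (w a) := rfl
      rw [e1, e2, ih]; rfl
  have w1 : ∀ i, w [i] = g i := fun i => rfl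
  have winv : ∀ l, ∃ l', w l' = (w l).symm := by
    intro l
    induction l with
    | nil => exact ⟨[], rfl⟩
    | cons i l ih =>
      obtain ⟨l', hl'⟩ := ih
      refine ⟨l' ++ [i], ?_⟩
      rw [wapp, hl', w1]
      conv_lhs => rw [← hs i]
      rfl
  have wE : ∀ l x, (x, w l x) ∈ E := by
    intro l
    induction l with
    | nil => exact fun x => hE.refl x
    | cons i l ih => exact fun x => hE.trans (hg i x) (ih (g i x))
  obtain ⟨e, he⟩ := exists_surjective_nat (List ι)
  refine ⟨fun n => w (e n), fun n => wE _, fun i => ?_, fun m n => ?_, fun n => ?_, ?_⟩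
  · obtain ⟨n, hn⟩ := he [i]
    exact ⟨n, by simp only [hn]; rfl⟩
  · obtain ⟨n, hn⟩ := he (e m ++ e n)
    exact ⟨n, by simp only [hn]; exact wapp _ _⟩
  · obtain ⟨l, hl⟩ := winv (e n)
    obtain ⟨n, hn⟩ := he l
    exact ⟨n, by simp only [hn]; exact hl⟩
  · obtain ⟨n, hn⟩ := he []
    exact ⟨n, by simp only [hn]; rfl⟩

lemma inv_hull {X : Type*} [MeasurableSpace X] (ν : Measure X) (E : Set (X × X))
    (hE : Equivalence (fun x y => (x, y) ∈ E))
    (hsat : ∀ N, ν N = 0 → ν (ESat E N) = 0) (N : Set X) (hN : ν N = 0) :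
    ∃ M, N ⊆ M ∧ MeasurableSet M ∧ ν M = 0 ∧ ∀ x y, (x, y) ∈ E → x ∈ M → y ∈ M := by
  let T : ℕ → Set X := fun n => Nat.rec (toMeasurable ν N) (fun _ S => toMeasurable ν (ESat E S)) n
  have hTs : ∀ n, T (n + 1) = toMeasurable ν (ESat E (T n)) := fun n => rfl
  have hT0 : ∀ n, ν (T n) = 0 := by
    intro n
    induction n with
    | zero => exact (measure_toMeasurable N).trans hN
    | succ n ih => rw [hTs, measure_toMeasurable]; exact hsat _ ih
  refine ⟨⋃ n, T n, ?_, ?_, measure_iUnion_null hT0, ?_⟩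
  · exact (subset_toMeasurable ν N).trans (subset_iUnion T 0)
  · refine MeasurableSet.iUnion fun n => ?_
    cases n
    · exact measurableSet_toMeasurable _ _
    · exact measurableSet_toMeasurable _ _
  · intro x y hxy hx
    obtain ⟨n, hn⟩ := mem_iUnion.1 hx
    refine mem_iUnion.2 ⟨n + 1, ?_⟩
    rw [hTs]
    exact subset_toMeasurable _ _ ⟨x, hn, hE.symm hxy⟩

lemma sat_null {X : Type*} [MeasurableSpace X] [StandardBorelSpace X] (μ : Measure X)
    [SigmaFinite μ] (E : Set (X × X)) (hE : IsCBER E) (hmcp : MCP μ E) (N : Set X) (hN : μ N = 0) :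
    μ (ESat E N) = 0 := by
  let M := toMeasurable μ N
  have hM : μ M = 0 := (measure_toMeasurable N).trans hN
  let A : Set (X × X) := E ∩ Prod.fst ⁻¹' M
  have hAm : MeasurableSet A := hE.1.inter (measurable_fst (measurableSet_toMeasurable _ _))
  have hL : nuL μ A = 0 := by
    unfold nuL lintL
    rw [← lintegral_zero (μ := μ)]
    apply lintegral_congr_ae
    have : ∀ᵐ x ∂μ, x ∉ M := measure_eq_zero_iff_ae_notMem.1 hM
    filter_upwards [this] with x hx
    have : IsEmpty {y : X // (x, y) ∈ A} := ⟨fun y => hx y.2.2⟩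
    simp
  have hR := (hmcp A inter_subset_left hAm).1 hL
  have hnm : NullMeasurableSet (Prod.snd '' A) μ :=
    (image_nullMeas μ.toFinite measurable_snd hAm).mono_ac (absolutelyContinuous_toFinite μ)
  obtain ⟨T, hTs, hTm, hTe⟩ := hnm.exists_measurable_subset_ae_eq
  have hle : μ T ≤ nuR μ A := by
    unfold nuR lintR
    rw [← lintegral_indicator_one hTm]
    apply lintegral_mono
    intro y
    by_cases hy : y ∈ T
    · obtain ⟨⟨a, b⟩, hab, rfl⟩ := hTs hy
      simp only [indicator_of_mem hy, Pi.one_apply]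
      exact ENNReal.le_tsum (f := fun _ : {z : X // (z, b) ∈ A} => (1 : ℝ≥0∞)) ⟨a, hab⟩
    · simp [hy]
  rw [hR, nonpos_iff_eq_zero, measure_congr hTe] at hle
  refine measure_mono_null ?_ hle
  rintro x ⟨y, hy, hxy⟩
  exact ⟨(y, x), ⟨hE.2.1.symm hxy, subset_toMeasurable _ _ hy⟩, rfl⟩


lemma feldman_moore {X : Type*} [MeasurableSpace X] [StandardBorelSpace X] (ν : Measure X)
    [IsFiniteMeasure ν] (E : Set (X × X)) (hE : IsCBER E)
    (hsat : ∀ N, ν N = 0 → ν (ESat E N) = 0) :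
    ∃ Y : Set X, MeasurableSet Y ∧ ν Yᶜ = 0 ∧ (∀ x y, (x, y) ∈ E → (x ∈ Y ↔ y ∈ Y)) ∧
    ∃ g : ℕ → X ≃ᵐ X, (∀ n x, (x, g n x) ∈ E) ∧
      (∀ x y, x ∈ Y → (x, y) ∈ E → ∃ n, g n x = y) ∧
      (∀ m n, ∃ k, g k = (g m).trans (g n)) ∧ (∀ n, ∃ k, g k = (g n).symm) := by
  have := hE.1.standardBorel
  obtain ⟨G, hGc, hG, hG0⟩ := LN ν (fun z : E => z.1.1) (measurable_fst.comp measurable_subtype_coe)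
    (by
      intro x
      have h1 := hE.2.2 x
      refine Set.countable_of_injective_of_countable_image (f := fun z : E => z.1.2) ?_
        (h1.mono ?_)
      · rintro ⟨⟨a, b⟩, h⟩ ha ⟨⟨c, d⟩, h'⟩ hc he
        simp only [mem_preimage, mem_singleton_iff] at ha hc he
        subst ha hc he
        rfl
      · rintro _ ⟨⟨⟨a, b⟩, h⟩, ha, rfl⟩
        simp only [mem_preimage, mem_singleton_iff] at ha
        subst ha
        exact h)
  obtain ⟨M, hNM, hMm, hM0, hMi⟩ := inv_hull ν E hE.2.1 hsat _ hG0
  have : Countable G := hGc.to_subtype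
  obtain ⟨S, hSm, hS⟩ := exists_seq_separating X (p := MeasurableSet) MeasurableSet.univ univ
  let V : ℕ × Bool → Set X := fun k => if k.2 then S k.1 else (S k.1)ᶜ
  have hV : ∀ k, MeasurableSet (V k) := by
    rintro ⟨k, b⟩
    cases b
    · exact (hSm k).compl
    · exact hSm k
  have hVs : ∀ x y, x ≠ y → ∃ k, x ∈ V k ∧ y ∉ V k := by
    intro x y hxy
    by_contra hh
    push Not at hh
    refine hxy (hS x trivial y trivial fun n => ⟨fun h => hh (n, true) h, fun h => ?_⟩)
    by_contra h'
    exact hh (n, false) h' h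
  let W : Set E → Set (X × X) := fun s => Subtype.val '' s
  have hW : ∀ s : G, MeasurableSet (W s) := fun s => hE.1.subtype_image (hG s.1 s.2).1
  have hWi : ∀ s : G, InjOn Prod.fst (W s) := by
    rintro s _ ⟨a, ha, rfl⟩ _ ⟨b, hb, rfl⟩ he
    exact congrArg Subtype.val ((hG s.1 s.2).2 ha hb he)
  let H : G × G × (ℕ × Bool) → Set (X × X) := fun i =>
    W i.1 ∩ Prod.swap ⁻¹' (W i.2.1) ∩ (Prod.fst ⁻¹' (V i.2.2) ∩ Prod.snd ⁻¹' (V i.2.2)ᶜ)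
  choose g hgs hgH hgc using fun i => exists_involution (H i)
    (((hW i.1).inter (measurable_swap (hW i.2.1))).inter
      ((measurable_fst (hV _)).inter (measurable_snd (hV _).compl)))
    (fun a ha b hb he => hWi i.1 ha.1.1 hb.1.1 he)
    (fun a ha b hb he => Prod.swap_injective (hWi i.2.1 ha.1.2 hb.1.2 he))
    (V i.2.2) (fun x y h => h.2.1) (fun x y h => h.2.2)
  have hHE : ∀ i, H i ⊆ E := by
    rintro i q ⟨⟨⟨a, -, rfl⟩, -⟩, -⟩
    exact a.2
  obtain ⟨g', h1, h2, h3, h4, ⟨k0, h5⟩⟩ := closure_words E hE.2.1 g hgs (by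
    intro i x
    rcases hgH i x with h | h | h
    · rw [h]; exact hE.2.1.refl x
    · exact hHE i h
    · exact hE.2.1.symm (hHE i h))
  have hcov : ∀ x y, (x, y) ∈ E → x ∉ M → ∃ s : G, (x, y) ∈ W s := by
    intro x y hxy hx
    by_contra hh
    push Not at hh
    apply hx
    apply hNM
    refine ⟨⟨(x, y), hxy⟩, ?_, rfl⟩
    rintro ⟨s, hs, hs'⟩
    exact hh ⟨s, hs⟩ ⟨_, hs', rfl⟩
  refine ⟨Mᶜ, hMm.compl, by rwa [compl_compl], ?_, g', h1, ?_, h3, h4⟩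
  · intro x y hxy
    exact ⟨fun h h' => h (hMi _ _ (hE.2.1.symm hxy) h'), fun h h' => h (hMi _ _ hxy h')⟩
  · intro x y hx hxy
    by_cases hne : x = y
    · subst hne
      exact ⟨k0, by rw [h5]; rfl⟩
    have hyx := hE.2.1.symm hxy
    have hy : y ∉ M := fun h => hx (hMi _ _ hyx h)
    obtain ⟨s, hs⟩ := hcov x y hxy hx
    obtain ⟨t, ht⟩ := hcov y x hyx hy
    obtain ⟨k, hk1, hk2⟩ := hVs x y hne
    obtain ⟨n, hn⟩ := h2 (s, t, k)
    exact ⟨n, by rw [hn]; exact hgc (s, t, k) x y ⟨⟨hs, ht⟩, hk1, hk2⟩⟩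

lemma greedy {X : Type*} [MeasurableSpace X] (ν : Measure X) [IsFiniteMeasure ν]
    (g : ℕ → X ≃ᵐ X) (ε : NNReal) (A B : Set X) (hA : MeasurableSet A) (hB : MeasurableSet B) :
    ∃ P : ℕ → Set X, (∀ n, MeasurableSet (P n)) ∧ (∀ n, P n ⊆ A) ∧ (∀ n, g n '' P n ⊆ B) ∧
      Pairwise (fun i j => Disjoint (P i) (P j)) ∧
      Pairwise (fun i j => Disjoint (g i '' P i) (g j '' P j)) ∧
      (∀ n, ν (g n '' P n) ≤ ε * ν (P n)) ∧
      ∀ n t, MeasurableSet t → t ⊆ A \ (⋃ n, P n) → g n '' t ⊆ B \ (⋃ n, g n '' P n) →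
        ε * ν t ≤ ν (g n '' t) := by
  have hmap : ∀ n t, MeasurableSet t → ν.map (g n).symm t = ν (g n '' t) := by
    intro n t ht
    rw [MeasurableEquiv.map_apply, MeasurableEquiv.image_eq_preimage_symm]
  choose s hsm hs1 hs2 using fun n => hahn_decomposition (ε • ν) (ν.map (g n).symm)
  let T : ℕ → Set X × Set X := fun n => Nat.rec (A, B) (fun n T =>
    (T.1 \ (T.1 ∩ g n ⁻¹' T.2 ∩ s n), T.2 \ g n '' (T.1 ∩ g n ⁻¹' T.2 ∩ s n))) n
  let P : ℕ → Set X := fun n => (T n).1 ∩ g n ⁻¹' (T n).2 ∩ s n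
  have hT1 : ∀ n, (T (n + 1)).1 = (T n).1 \ P n := fun n => rfl
  have hT2 : ∀ n, (T (n + 1)).2 = (T n).2 \ g n '' P n := fun n => rfl
  have hTm : ∀ n, MeasurableSet (T n).1 ∧ MeasurableSet (T n).2 := by
    intro n
    induction n with
    | zero => exact ⟨hA, hB⟩
    | succ n ih =>
      have hP : MeasurableSet (P n) := (ih.1.inter ((g n).measurable ih.2)).inter (hsm n)
      rw [hT1, hT2]
      exact ⟨ih.1.diff hP, ih.2.diff ((g n).measurableSet_image.2 hP)⟩
  have hPm : ∀ n, MeasurableSet (P n) := fun n =>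
    ((hTm n).1.inter ((g n).measurable (hTm n).2)).inter (hsm n)
  have hanti1 : Antitone fun n => (T n).1 := antitone_nat_of_succ_le fun n => by
    rw [hT1]; exact sdiff_subset
  have hanti2 : Antitone fun n => (T n).2 := antitone_nat_of_succ_le fun n => by
    rw [hT2]; exact sdiff_subset
  have hP1 : ∀ n, P n ⊆ (T n).1 := fun n x hx => hx.1.1
  have hP2 : ∀ n, g n '' P n ⊆ (T n).2 := by rintro n _ ⟨x, hx, rfl⟩; exact hx.1.2
  have hd1 : ∀ i j, i < j → Disjoint (P i) (P j) := by
    intro i j hij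
    rw [Set.disjoint_left]
    intro x hx hx'
    have := hanti1 (Nat.succ_le_of_lt hij) (hP1 j hx')
    exact this.2 hx
  have hd2 : ∀ i j, i < j → Disjoint (g i '' P i) (g j '' P j) := by
    intro i j hij
    rw [Set.disjoint_left]
    intro x hx hx'
    have := hanti2 (Nat.succ_le_of_lt hij) (hP2 j hx')
    exact this.2 hx
  have hin1 : ∀ n x, x ∈ A \ (⋃ n, P n) → x ∈ (T n).1 := by
    rintro n x ⟨hx, hx'⟩
    induction n with
    | zero => exact hx
    | succ n ih => rw [hT1]; exact ⟨ih, fun h => hx' (mem_iUnion.2 ⟨n, h⟩)⟩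
  have hin2 : ∀ n x, x ∈ B \ (⋃ n, g n '' P n) → x ∈ (T n).2 := by
    rintro n x ⟨hx, hx'⟩
    induction n with
    | zero => exact hx
    | succ n ih => rw [hT2]; exact ⟨ih, fun h => hx' (mem_iUnion.2 ⟨n, h⟩)⟩
  refine ⟨P, hPm, fun n => (hP1 n).trans (hanti1 (Nat.zero_le n)),
    fun n => (hP2 n).trans (hanti2 (Nat.zero_le n)), ?_, ?_, ?_, ?_⟩
  · intro i j hij
    rcases lt_or_gt_of_ne hij with h | h
    · exact hd1 i j h
    · exact (hd1 j i h).symm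
  · intro i j hij
    rcases lt_or_gt_of_ne hij with h | h
    · exact hd2 i j h
    · exact (hd2 j i h).symm
  · intro n
    have := hs1 n (P n) (hPm n) inter_subset_right
    rw [hmap n _ (hPm n)] at this
    exact this
  · intro n t ht htA htB
    have h1 : t ⊆ (s n)ᶜ := by
      intro x hx hxs
      have h2 : x ∈ P n := ⟨⟨hin1 n x (htA hx), hin2 n _ (htB ⟨x, hx, rfl⟩)⟩, hxs⟩
      exact (htA hx).2 (mem_iUnion.2 ⟨n, h2⟩)
    have := hs2 n t ht h1
    rw [hmap n _ ht] at this
    exact this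


lemma inv_of_gens {X : Type*} [MeasurableSpace X] [StandardBorelSpace X] (m : Measure X)
    (E : Set (X × X)) (Y : Set X) (hYm : MeasurableSet Y) (hY0 : m Yᶜ = 0)
    (hYi : ∀ x y, (x, y) ∈ E → (x ∈ Y ↔ y ∈ Y)) (g : ℕ → X ≃ᵐ X)
    (hcov : ∀ x y, x ∈ Y → (x, y) ∈ E → ∃ n, g n x = y)
    (hinv : ∀ n, m.map (g n) = m) : InvariantUnder m E := by
  have hinv' : ∀ n t, MeasurableSet t → m (g n '' t) = m t := by
    intro n t ht
    conv_lhs => rw [← hinv n]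
    rw [MeasurableEquiv.map_apply, preimage_image_eq _ (g n).injective]
  have hmY : ∀ t, m t = m (t ∩ Y) := by
    intro t
    refine le_antisymm ?_ (measure_mono inter_subset_left)
    calc m t ≤ m (t ∩ Y ∪ Yᶜ) := measure_mono (by
          intro x hx; by_cases h : x ∈ Y
          · exact Or.inl ⟨hx, h⟩
          · exact Or.inr h)
      _ ≤ m (t ∩ Y) + m Yᶜ := measure_union_le _ _
      _ = m (t ∩ Y) := by rw [hY0, add_zero]
  intro f A hf hA hinj hfE
  have hfA : MeasurableSet (f '' A) := hA.image_of_measurable_injOn hf hinj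
  ext S hS
  rw [Measure.map_apply hf hS, Measure.restrict_apply (hf hS), Measure.restrict_apply hS]
  rw [hmY (f ⁻¹' S ∩ A), hmY (S ∩ f '' A)]
  let Q : ℕ → Set X := disjointed fun n => {x | f x = g n x}
  have hQm : ∀ n, MeasurableSet (Q n) := fun n =>
    MeasurableSet.disjointed (fun n => measurableSet_eq_fun hf (g n).measurable) n
  have hQf : ∀ n x, x ∈ Q n → f x = g n x := fun n x hx => disjointed_subset _ n hx
  let T : ℕ → Set X := fun n => (f ⁻¹' S ∩ A ∩ Y) ∩ Q n
  have hTm : ∀ n, MeasurableSet (T n) := fun n => (((hf hS).inter hA).inter hYm).inter (hQm n)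
  have e1 : f ⁻¹' S ∩ A ∩ Y = ⋃ n, T n := by
    rw [← inter_iUnion]
    symm
    rw [inter_eq_left]
    intro x hx
    rw [iUnion_disjointed]
    obtain ⟨n, hn⟩ := hcov x (f x) hx.2 (hfE x hx.1.2)
    exact mem_iUnion.2 ⟨n, hn.symm⟩
  have e2 : S ∩ f '' A ∩ Y = ⋃ n, g n '' T n := by
    have h1 : S ∩ f '' A ∩ Y = f '' (f ⁻¹' S ∩ A ∩ Y) := by
      ext y
      constructor
      · rintro ⟨⟨hy, x, hx, rfl⟩, hyY⟩
        exact ⟨x, ⟨⟨hy, hx⟩, (hYi _ _ (hfE x hx)).2 hyY⟩, rfl⟩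
      · rintro ⟨x, ⟨⟨hxS, hx⟩, hxY⟩, rfl⟩
        exact ⟨⟨hxS, x, hx, rfl⟩, (hYi _ _ (hfE x hx)).1 hxY⟩
    rw [h1, e1, image_iUnion]
    congr 1
    ext1 n
    exact image_congr fun x hx => hQf n x hx.2
  have hdT : Pairwise (fun i j => Disjoint (T i) (T j)) := fun i j hij =>
    (disjoint_disjointed (fun n => {x | f x = g n x}) hij).mono inter_subset_right inter_subset_right
  have hdI : Pairwise (fun i j => Disjoint (g i '' T i) (g j '' T j)) := by
    intro i j hij
    rw [Set.disjoint_left]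
    rintro _ ⟨x, hx, rfl⟩ ⟨y, hy, hxy⟩
    rw [← hQf i x hx.2, ← hQf j y hy.2] at hxy
    have := hinj hy.1.1.2 hx.1.1.2 hxy
    subst this
    exact Set.disjoint_left.1 (hdT hij) hx hy
  rw [e1, e2, measure_iUnion hdT hTm, measure_iUnion hdI fun n => (g n).measurableSet_image.2 (hTm n)]
  exact tsum_congr fun n => (hinv' n _ (hTm n)).symm

lemma exists_inv {X : Type*} [MeasurableSpace X] [StandardBorelSpace X] (ν : Measure X)
    [IsFiniteMeasure ν]
    (E : Set (X × X)) (Y : Set X) (hYm : MeasurableSet Y) (hY0 : ν Yᶜ = 0)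
    (hYi : ∀ x y, (x, y) ∈ E → (x ∈ Y ↔ y ∈ Y)) (g : ℕ → X ≃ᵐ X)
    (hcov : ∀ x y, x ∈ Y → (x, y) ∈ E → ∃ n, g n x = y)
    (hcomp : ∀ m n, ∃ k, g k = (g m).trans (g n)) (hsymm : ∀ n, ∃ k, g k = (g n).symm)
    (hqi : ∀ n N, ν N = 0 → ν (g n ⁻¹' N) = 0)
    (herg : ∀ S, MeasurableSet S → ν S ≠ 0 → ν (⋃ n, g n ⁻¹' S)ᶜ = 0)
    (C D : Set X) (hC : MeasurableSet C) (hD : MeasurableSet D) (hC0 : ν C ≠ 0) (hD0 : ν D ≠ 0)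
    (ε : NNReal) (hε : ε ≠ 0)
    (h : ∀ n t, MeasurableSet t → t ⊆ C → g n '' t ⊆ D → ε * ν t ≤ ν (g n '' t)) :
    ∃ m : Measure X, SigmaFinite m ∧ EquivMeasure m ν ∧ InvariantUnder m E := by
  let η : ℕ → Measure X := fun n => (ν.restrict C).map (g n)
  let m : Measure X := ⨆ n, η n
  have hη : ∀ n S, MeasurableSet S → η n S = ν (g n ⁻¹' S ∩ C) := fun n S hS => by
    rw [MeasurableEquiv.map_apply, Measure.restrict_apply ((g n).measurable hS)]
  have hηac : ∀ n, η n ≪ ν := fun n => by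
    refine Measure.AbsolutelyContinuous.mk fun S hS h0 => ?_
    rw [hη n S hS]
    exact measure_mono_null inter_subset_left (hqi n S h0)
  -- invariance
  have hle : ∀ n, m.map (g n) ≤ m := by
    intro n
    have h1 : m ≤ m.map (g n).symm := by
      refine iSup_le fun k => ?_
      obtain ⟨j, hj⟩ := hcomp k n
      have h2 : (η j).map (g n).symm = η k := by
        change ((ν.restrict C).map (g j)).map (g n).symm = (ν.restrict C).map (g k)
        rw [hj, Measure.map_map (g n).symm.measurable ((g k).trans (g n)).measurable]
        congr 1
        ext x
        simp
      rw [← h2]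
      exact Measure.map_mono (le_iSup η j) (g n).symm.measurable
    calc m.map (g n) ≤ (m.map (g n).symm).map (g n) := Measure.map_mono h1 (g n).measurable
      _ = m := by
        rw [Measure.map_map (g n).measurable (g n).symm.measurable]
        simp
  have hinv : ∀ n, m.map (g n) = m := by
    intro n
    refine le_antisymm (hle n) ?_
    obtain ⟨k, hk⟩ := hsymm n
    have h1 := Measure.map_mono (hle k) (g n).measurable
    rw [Measure.map_map (g n).measurable (g k).measurable, hk] at h1
    simpa using h1
  have hmac : m ≪ ν := by
    have h1 : m ≤ Measure.sum η := iSup_le fun n => Measure.le_sum η n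
    refine (Measure.absolutelyContinuous_of_le h1).trans ?_
    exact Measure.absolutelyContinuous_sum_left hηac
  have hacm : ν ≪ m := by
    refine Measure.AbsolutelyContinuous.mk fun S hS h0 => ?_
    have h1 : ∀ n, ν (g n ⁻¹' S ∩ C) = 0 := by
      intro n
      rw [← hη n S hS]
      exact le_antisymm ((le_iSup η n S).trans h0.le) (zero_le)
    have h2 : ∀ n, ν (S ∩ g n ⁻¹' C) = 0 := by
      intro n
      obtain ⟨k, hk⟩ := hsymm n
      have := hqi n _ (h1 k)
      refine measure_mono_null ?_ this
      rintro x ⟨hx, hx'⟩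
      refine ⟨?_, hx'⟩
      simp [hk, hx]
    refine measure_mono_null ?_ (measure_union_null (measure_iUnion_null h2) (herg C hC hC0))
    intro x hx
    by_cases hx' : x ∈ ⋃ n, g n ⁻¹' C
    · obtain ⟨n, hn⟩ := mem_iUnion.1 hx'
      exact Or.inl (mem_iUnion.2 ⟨n, hx, hn⟩)
    · exact Or.inr hx'
  have hfin : m D < ∞ := by
    let m' : Measure X := ((ε⁻¹ : NNReal) : ℝ≥0∞) • ν.restrict D + (∞ : ℝ≥0∞) • ν.restrict Dᶜ
    have h1 : m ≤ m' := by
      refine iSup_le fun n => Measure.le_iff.2 fun S hS => ?_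
      rw [← measure_inter_add_sdiff S hD]
      have e : m' S = ((ε⁻¹ : NNReal) : ℝ≥0∞) * ν (S ∩ D) + ∞ * ν (S \ D) := by
        simp [m', Measure.restrict_apply hS, Set.sdiff_eq]
      rw [e]
      refine add_le_add ?_ ?_
      · rw [hη n _ (hS.inter hD)]
        have h2 := h n (g n ⁻¹' (S ∩ D) ∩ C) (((g n).measurable (hS.inter hD)).inter hC)
          inter_subset_right (by rintro _ ⟨x, hx, rfl⟩; exact hx.1.2)
        have h3 : ν (g n '' (g n ⁻¹' (S ∩ D) ∩ C)) ≤ ν (S ∩ D) :=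
          measure_mono (by rintro _ ⟨x, hx, rfl⟩; exact hx.1)
        calc ν (g n ⁻¹' (S ∩ D) ∩ C)
            = ((ε⁻¹ : NNReal) : ℝ≥0∞) * (ε * ν (g n ⁻¹' (S ∩ D) ∩ C)) := by
              rw [← mul_assoc, ← ENNReal.coe_mul, inv_mul_cancel₀ hε]; simp
          _ ≤ _ := by gcongr; exact h2.trans h3
      · by_cases h0 : ν (S \ D) = 0
        · rw [hηac n h0]; exact zero_le
        · rw [ENNReal.top_mul h0]; exact le_top
    refine (h1 D).trans_lt ?_
    have e : m' D = ((ε⁻¹ : NNReal) : ℝ≥0∞) * ν D := by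
      simp [m', Measure.restrict_apply hD]
    rw [e]
    exact ENNReal.mul_lt_top ENNReal.coe_lt_top (measure_lt_top _ _)
  refine ⟨m, ?_, ⟨hmac, hacm⟩, inv_of_gens m E Y hYm (hmac hY0) hYi g hcov hinv⟩
  refine Measure.sigmaFinite_of_countable
    (S := insert (⋃ n, g n ⁻¹' D)ᶜ (range fun n => g n ⁻¹' D)) ((countable_range _).insert _) ?_ ?_
  · rintro s (rfl | ⟨n, rfl⟩)
    · rw [hmac (herg D hD hD0)]; exact ENNReal.zero_lt_top
    · have : m (g n ⁻¹' D) = m D := by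
        conv_rhs => rw [← hinv n]
        rw [MeasurableEquiv.map_apply]
      simp only [this]; exact hfin
  · rw [sUnion_insert, sUnion_range, compl_union_self]


lemma glue {X : Type*} [MeasurableSpace X] [StandardBorelSpace X] (g : ℕ → X ≃ᵐ X)
    (P : ℕ → Set X) (hP : ∀ n, MeasurableSet (P n))
    (hd : Pairwise (fun i j => Disjoint (P i) (P j))) :
    ∃ f : X → X, Measurable f ∧ ∀ n, ∀ x ∈ P n, f x = g n x := by
  classical
  let f : X → X := fun x => if h : ∃ n, x ∈ P n then g h.choose x else x
  have hf : ∀ n, ∀ x ∈ P n, f x = g n x := by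
    intro n x hx
    have h : ∃ n, x ∈ P n := ⟨n, hx⟩
    have e : f x = g h.choose x := dif_pos h
    have e2 : h.choose = n := by
      by_contra hne
      exact Set.disjoint_left.1 (hd hne) h.choose_spec hx
    rw [e, e2]
  have hf' : ∀ x, (∀ n, x ∉ P n) → f x = x := fun x hx => dif_neg (by push Not; exact hx)
  refine ⟨f, measurable_of_graph f ?_, hf⟩
  have : {q : X × X | f q.1 = q.2} = (⋃ n, Prod.fst ⁻¹' P n ∩ {q | g n q.1 = q.2}) ∪
      (Prod.fst ⁻¹' (⋃ n, P n)ᶜ ∩ {q | q.1 = q.2}) := by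
    ext ⟨x, y⟩
    by_cases h : ∃ n, x ∈ P n
    · obtain ⟨n, hn⟩ := h
      constructor
      · intro h
        have h' : f x = y := h
        exact Or.inl (mem_iUnion.2 ⟨n, hn, (hf n x hn).symm.trans h'⟩)
      · rintro (h | h)
        · obtain ⟨k, hk, hk'⟩ := mem_iUnion.1 h
          exact (hf k x hk).trans hk'
        · exact absurd (mem_iUnion.2 ⟨n, hn⟩) h.1
    · push Not at h
      constructor
      · intro h'
        have h' : f x = y := h'
        rw [hf' x h] at h'
        exact Or.inr ⟨fun hh => by obtain ⟨n, hn⟩ := mem_iUnion.1 hh; exact h n hn, h'⟩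
      · rintro (h' | h')
        · obtain ⟨k, hk, hk'⟩ := mem_iUnion.1 h'
          exact absurd hk (h k)
        · exact (hf' x h).trans h'.2
  rw [this]
  refine (MeasurableSet.iUnion fun n => (measurable_fst (hP n)).inter ?_).union
    ((measurable_fst (MeasurableSet.iUnion hP).compl).inter ?_)
  · exact measurableSet_eq_fun ((g n).measurable.comp measurable_fst) measurable_snd
  · exact measurableSet_eq_fun measurable_fst measurable_snd

lemma schroeder {X : Type*} [MeasurableSpace X] [StandardBorelSpace X] (E : Set (X × X))
    (hE : Equivalence (fun x y => (x, y) ∈ E)) (A B : Set X) (hA : MeasurableSet A)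
    (hB : MeasurableSet B) (f g : X → X) (hf : Measurable f) (hg : Measurable g)
    (hfi : InjOn f A) (hgi : InjOn g B) (hfm : MapsTo f A B) (hgm : MapsTo g B A)
    (hfE : ∀ x ∈ A, (x, f x) ∈ E) (hgE : ∀ x ∈ B, (x, g x) ∈ E) :
    ∃ h : X → X, Measurable h ∧ BijOn h A B ∧ ∀ x ∈ A, (x, h x) ∈ E := by
  classical
  let C : ℕ → Set X := fun n => Nat.rec (A \ g '' B) (fun _ S => g '' (f '' S)) n
  have hCs : ∀ n, C (n + 1) = g '' (f '' C n) := fun n => rfl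
  have hgB : MeasurableSet (g '' B) := hB.image_of_measurable_injOn hg hgi
  have hCA : ∀ n, MeasurableSet (C n) ∧ C n ⊆ A := by
    intro n
    induction n with
    | zero => exact ⟨hA.diff hgB, sdiff_subset⟩
    | succ n ih =>
      rw [hCs]
      have h1 : MeasurableSet (f '' C n) := ih.1.image_of_measurable_injOn hf (hfi.mono ih.2)
      have h2 : f '' C n ⊆ B := by rintro _ ⟨x, hx, rfl⟩; exact hfm (ih.2 hx)
      exact ⟨h1.image_of_measurable_injOn hg (hgi.mono h2), by
        rintro _ ⟨x, hx, rfl⟩; exact hgm (h2 hx)⟩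
  let U : Set X := ⋃ n, C n
  have hU : MeasurableSet U := MeasurableSet.iUnion fun n => (hCA n).1
  have hUA : U ⊆ A := iUnion_subset fun n => (hCA n).2
  have hUgf : ∀ x ∈ U, g (f x) ∈ U := by
    intro x hx
    obtain ⟨n, hn⟩ := mem_iUnion.1 hx
    exact mem_iUnion.2 ⟨n + 1, ⟨f x, ⟨x, hn, rfl⟩, rfl⟩⟩
  have hUc : ∀ x ∈ A, x ∉ U → x ∈ g '' B := by
    intro x hx hxU
    by_contra hh
    exact hxU (mem_iUnion.2 ⟨0, hx, hh⟩)
  have hUb : ∀ y ∈ B, g y ∈ U → ∃ x ∈ U, f x = y := by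
    intro y hy hgy
    obtain ⟨n, hn⟩ := mem_iUnion.1 hgy
    cases n with
    | zero => exact absurd ⟨y, hy, rfl⟩ hn.2
    | succ n =>
      obtain ⟨_, ⟨x, hx, rfl⟩, he⟩ := hn
      exact ⟨x, mem_iUnion.2 ⟨n, hx⟩, hgi (hfm ((hCA n).2 hx)) hy he⟩
  let h : X → X := fun x => if x ∈ U then f x else
    if hx : ∃ y, y ∈ B ∧ g y = x then hx.choose else x
  have h1 : ∀ x ∈ U, h x = f x := fun x hx => if_pos hx
  have h2 : ∀ y ∈ B, g y ∉ U → h (g y) = y := by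
    intro y hy hgy
    have hx : ∃ z, z ∈ B ∧ g z = g y := ⟨y, hy, rfl⟩
    have e : h (g y) = hx.choose := (if_neg hgy).trans (dif_pos hx)
    rw [e]
    exact hgi hx.choose_spec.1 hy hx.choose_spec.2
  have h3 : ∀ x, x ∉ U → x ∉ g '' B → h x = x := by
    intro x hx hx'
    exact (if_neg hx).trans (dif_neg hx')
  refine ⟨h, measurable_of_graph h ?_, ⟨?_, ?_, ?_⟩, ?_⟩
  · have : {q : X × X | h q.1 = q.2} = (Prod.fst ⁻¹' U ∩ {q | f q.1 = q.2}) ∪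
      (Prod.fst ⁻¹' Uᶜ ∩ Prod.snd ⁻¹' B ∩ {q | g q.2 = q.1}) ∪
      (Prod.fst ⁻¹' (U ∪ g '' B)ᶜ ∩ {q | q.1 = q.2}) := by
      ext ⟨x, y⟩
      constructor
      · intro hxy
        have hxy : h x = y := hxy
        by_cases hx : x ∈ U
        · exact Or.inl (Or.inl ⟨hx, (h1 x hx).symm.trans hxy⟩)
        by_cases hx' : x ∈ g '' B
        · obtain ⟨z, hz, rfl⟩ := hx'
          rw [h2 z hz hx] at hxy
          subst hxy
          exact Or.inl (Or.inr ⟨⟨hx, hz⟩, rfl⟩)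
        · rw [h3 x hx hx'] at hxy
          exact Or.inr ⟨fun hh => hh.elim hx hx', hxy⟩
      · rintro ((⟨hx, he⟩ | ⟨⟨hx, hy⟩, he⟩) | ⟨hx, he⟩)
        · exact (h1 x hx).trans he
        · have he : g y = x := he
          subst he
          exact h2 y hy hx
        · exact (h3 x (fun h => hx (Or.inl h)) (fun h => hx (Or.inr h))).trans he
    rw [this]
    refine (((measurable_fst hU).inter ?_).union
      (((measurable_fst hU.compl).inter (measurable_snd hB)).inter ?_)).union
      ((measurable_fst (hU.union hgB).compl).inter ?_)
    · exact measurableSet_eq_fun (hf.comp measurable_fst) measurable_snd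
    · exact measurableSet_eq_fun (hg.comp measurable_snd) measurable_fst
    · exact measurableSet_eq_fun measurable_fst measurable_snd
  · intro x hx
    by_cases hxU : x ∈ U
    · rw [h1 x hxU]; exact hfm hx
    · obtain ⟨y, hy, rfl⟩ := hUc x hx hxU
      rw [h2 y hy hxU]; exact hy
  · have key : ∀ x ∈ A, ∀ y ∈ A, x ∈ U → y ∉ U → h x ≠ h y := by
      intro x hx y hy hxU hyU he
      obtain ⟨z, hz, rfl⟩ := hUc y hy hyU
      rw [h1 x hxU, h2 z hz hyU] at he
      subst he
      exact hyU (hUgf x hxU)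
    intro x hx y hy he
    by_cases hxU : x ∈ U <;> by_cases hyU : y ∈ U
    · rw [h1 x hxU, h1 y hyU] at he
      exact hfi hx hy he
    · exact absurd he (key x hx y hy hxU hyU)
    · exact absurd he.symm (key y hy x hx hyU hxU)
    · obtain ⟨z, hz, rfl⟩ := hUc y hy hyU
      obtain ⟨w, hw, rfl⟩ := hUc x hx hxU
      rw [h2 z hz hyU, h2 w hw hxU] at he
      rw [he]
  · intro y hy
    by_cases hgy : g y ∈ U
    · obtain ⟨x, hx, rfl⟩ := hUb y hy hgy
      exact ⟨x, hUA hx, h1 x hx⟩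
    · exact ⟨g y, hgm hy, h2 y hy hgy⟩
  · intro x hx
    by_cases hxU : x ∈ U
    · rw [h1 x hxU]; exact hfE x hx
    · obtain ⟨y, hy, rfl⟩ := hUc x hx hxU
      rw [h2 y hy hxU]; exact hE.symm (hgE y hy)

theorem typeIII_full_pseudogroup_bijection {X : Type*} [MeasurableSpace X]
    [StandardBorelSpace X]
    (μ : Measure X) [SigmaFinite μ]
    (E : Set (X × X)) (hE : IsCBER E) (hmcp : MCP μ E)
    (hpe : ProperlyErgodicRel μ E) (hIII : IsTypeIII μ E)
    (A B : Set X) (hA : MeasurableSet A) (hB : MeasurableSet B)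
    (hAnn : μ A ≠ 0) (hBnn : μ B ≠ 0) :
    ∃ f : X → X, Measurable f ∧
      ∃ A' B' : Set X, MeasurableSet A' ∧ MeasurableSet B' ∧
        A' ⊆ A ∧ B' ⊆ B ∧ μ (A \ A') = 0 ∧ μ (B \ B') = 0 ∧
        Set.BijOn f A' B' ∧ ∀ x ∈ A', (x, f x) ∈ E := by
  let ν := μ.toFinite
  have hνμ : ν ≪ μ := toFinite_absolutelyContinuous μ
  have hμν : μ ≪ ν := absolutelyContinuous_toFinite μ
  have hsat : ∀ N, ν N = 0 → ν (ESat E N) = 0 := fun N hN =>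
    hνμ (sat_null μ E hE hmcp N (hμν hN))
  obtain ⟨Y, hYm, hY0, hYi, g, hgE, hcov, hcomp, hsymm⟩ := feldman_moore ν E hE hsat
  have hqi : ∀ n N, ν N = 0 → ν (g n ⁻¹' N) = 0 := fun n N hN =>
    measure_mono_null (t := ESat E N) (fun x hx => ⟨g n x, hx, hgE n x⟩) (hsat N hN)
  have herg : ∀ S, MeasurableSet S → ν S ≠ 0 → ν (⋃ n, g n ⁻¹' S)ᶜ = 0 := by
    intro S hS hS0
    have h1 := hνμ (hpe.1 S hS fun h => hS0 (hνμ h))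
    refine measure_mono_null ?_ (measure_union_null h1 hY0)
    intro x hx
    by_contra hh
    rw [mem_union, not_or, notMem_compl_iff, notMem_compl_iff] at hh
    obtain ⟨⟨y, hy, hxy⟩, hxY⟩ := hh
    obtain ⟨n, hn⟩ := hcov x y hxY hxy
    exact hx (mem_iUnion.2 ⟨n, by rw [mem_preimage, hn]; exact hy⟩)
  have emb : ∀ A B : Set X, MeasurableSet A → MeasurableSet B → ν A ≠ 0 → ν B ≠ 0 →
      ∃ f : X → X, Measurable f ∧ ∃ A' ⊆ A, ν (A \ A') = 0 ∧ InjOn f A' ∧ MapsTo f A' B ∧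
        ∀ x ∈ A', (x, f x) ∈ E := by
    intro A B hA hB hA0 hB0
    obtain ⟨ε, hε, hlt⟩ := ENNReal.exists_nnreal_pos_mul_lt (measure_ne_top ν A) hB0
    obtain ⟨P, hPm, hPA, hPB, hd1, hd2, hle, hge⟩ := greedy ν g ε A B hA hB
    obtain ⟨f, hf, hfP⟩ := glue g P hPm hd1
    have hgPm : ∀ n, MeasurableSet (g n '' P n) := fun n => (g n).measurableSet_image.2 (hPm n)
    refine ⟨f, hf, ⋃ n, P n, iUnion_subset hPA, ?_, ?_, ?_, ?_⟩
    · by_contra hA1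
      have hB1 : ν (B \ ⋃ n, g n '' P n) ≠ 0 := by
        intro h0
        have h1 : ν B ≤ ν (⋃ n, g n '' P n) := by
          calc ν B ≤ ν ((B \ ⋃ n, g n '' P n) ∪ ⋃ n, g n '' P n) := measure_mono (by
                rw [sdiff_union_self]; exact subset_union_left)
            _ ≤ _ := measure_union_le _ _
            _ = _ := by rw [h0, zero_add]
        have h2 : ν (⋃ n, g n '' P n) ≤ ε * ν A := by
          calc ν (⋃ n, g n '' P n) ≤ ∑' n, ν (g n '' P n) := measure_iUnion_le _
            _ ≤ ∑' n, ε * ν (P n) := ENNReal.tsum_le_tsum hle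
            _ = ε * ν (⋃ n, P n) := by rw [ENNReal.tsum_mul_left, measure_iUnion hd1 hPm]
            _ ≤ ε * ν A := by gcongr; exact iUnion_subset hPA
        exact absurd (h1.trans h2) (not_le.2 hlt)
      obtain ⟨m, hm1, hm2, hm3⟩ := exists_inv ν E Y hYm hY0 hYi g hcov hcomp hsymm hqi herg
        (A \ ⋃ n, P n) (B \ ⋃ n, g n '' P n) (hA.diff (MeasurableSet.iUnion hPm))
        (hB.diff (MeasurableSet.iUnion hgPm)) hA1 hB1 ε hε.ne' hge
      exact hIII ⟨m, hm1, ⟨hm2.1.trans hνμ, hμν.trans hm2.2⟩, hm3⟩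
    · intro x hx y hy he
      obtain ⟨i, hi⟩ := mem_iUnion.1 hx
      obtain ⟨j, hj⟩ := mem_iUnion.1 hy
      rw [hfP i x hi, hfP j y hj] at he
      by_cases hij : i = j
      · subst hij; exact (g i).injective he
      · exact absurd ⟨y, hj, he.symm⟩ (Set.disjoint_left.1 (hd2 hij) ⟨x, hi, rfl⟩)
    · intro x hx
      obtain ⟨i, hi⟩ := mem_iUnion.1 hx
      rw [hfP i x hi]
      exact hPB i ⟨x, hi, rfl⟩
    · intro x hx
      obtain ⟨i, hi⟩ := mem_iUnion.1 hx
      rw [hfP i x hi]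
      exact hgE i x
  have hA0 : ν A ≠ 0 := fun h => hAnn (hμν h)
  have hB0 : ν B ≠ 0 := fun h => hBnn (hμν h)
  obtain ⟨f, hf, A', hA'A, hA'0, hfi, hfm, hfE⟩ := emb A B hA hB hA0 hB0
  obtain ⟨k, hk, B', hB'B, hB'0, hki, hkm, hkE⟩ := emb B A hB hA hB0 hA0
  obtain ⟨M, hNM, hMm, hM0, hMi⟩ := inv_hull ν E hE.2.1 hsat _ (measure_union_null hA'0 hB'0)
  have hMi' : ∀ x y, (x, y) ∈ E → x ∉ M → y ∉ M := fun x y hxy hx hy =>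
    hx (hMi _ _ (hE.2.1.symm hxy) hy)
  have hAM : A \ M ⊆ A' := by
    rintro x ⟨hx, hx'⟩
    by_contra h; exact hx' (hNM (Or.inl ⟨hx, h⟩))
  have hBM : B \ M ⊆ B' := by
    rintro x ⟨hx, hx'⟩
    by_contra h; exact hx' (hNM (Or.inr ⟨hx, h⟩))
  obtain ⟨h, hh, hbij, hhE⟩ := schroeder E hE.2.1 (A \ M) (B \ M) (hA.diff hMm) (hB.diff hMm)
    f k hf hk (hfi.mono hAM) (hki.mono hBM)
    (fun x hx => ⟨hfm (hAM hx), hMi' _ _ (hfE x (hAM hx)) hx.2⟩)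
    (fun x hx => ⟨hkm (hBM hx), hMi' _ _ (hkE x (hBM hx)) hx.2⟩)
    (fun x hx => hfE x (hAM hx)) (fun x hx => hkE x (hBM hx))
  refine ⟨h, hh, A \ M, B \ M, hA.diff hMm, hB.diff hMm, sdiff_subset, sdiff_subset, ?_, ?_,
    hbij, hhE⟩
  · exact measure_mono_null (by rw [Set.sdiff_sdiff_right_self]; exact inter_subset_right) (hμν hM0)
  · exact measure_mono_null (by rw [Set.sdiff_sdiff_right_self]; exact inter_subset_right) (hμν hM0)
end
end

section
/- Let (X, μ, E) be an mcp CBER and let F ⊆ E be a subrelation which is a properly ergodic mcp CBER of type III with respect to μ. Define the equivalence relation F^(2) on the space (E, ν_l) by: e F^(2) e' if and only if s(e) F s(e'), where s denotes the first-coordinate projection E → X. Then (E, ν_l, F^(2)) is a countable Borel equivalence relation that is mcp, ergodic, and of type III. -/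
open MeasureTheory Set Filter
open scoped ENNReal ENat Topology

noncomputable section

variable {X : Type*}

theorem aux_compact_tube (s : ℕ → ℕ) (V : Set (ℕ → ℕ)) (hV : IsOpen V)
    (hK : {x : ℕ → ℕ | ∀ i, x i ≤ s i} ⊆ V) :
    ∃ n : ℕ, {x : ℕ → ℕ | ∀ i < n, x i ≤ s i} ⊆ V := by
  by_contra! hcon
  have hcon' : ∀ n : ℕ, ∃ x : ℕ → ℕ, (∀ i < n, x i ≤ s i) ∧ x ∉ V := by
    intro n
    obtain ⟨x, hx, hxV⟩ := Set.not_subset.1 (hcon n)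
    exact ⟨x, hx, hxV⟩
  choose x hx hxV using hcon'
  have hKc : IsCompact {x : ℕ → ℕ | ∀ i, x i ≤ s i} := by
    have h := isCompact_univ_pi (X := fun _ : ℕ => ℕ) (s := fun i => Set.Iic (s i))
      (fun i => (Set.finite_Iic (s i)).isCompact)
    convert h using 1
    ext x; simp [Pi.le_def]
  obtain ⟨y, hy, φ, hφ, hlim⟩ := hKc.tendsto_subseq
    (x := fun n i => min (x n i) (s i)) (fun n i => min_le_right _ _)
  have hlim2 : Tendsto (fun n => x (φ n)) atTop (𝓝 y) := by
    rw [tendsto_pi_nhds] at hlim ⊢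
    intro i
    refine (hlim i).congr' ?_
    filter_upwards [eventually_gt_atTop i] with n hn
    exact min_eq_left (hx (φ n) i (hn.trans_le (hφ.id_le n)))
  have := hlim2.eventually (hV.mem_nhds (hK hy))
  obtain ⟨n, hn⟩ := this.exists
  exact hxV _ hn

theorem aux_capacity {X : Type*} [TopologicalSpace X] [PolishSpace X] [MeasurableSpace X]
    [BorelSpace X] (μ : Measure X) [IsFiniteMeasure μ] (ψ : (ℕ → ℕ) → X) (hψ : Continuous ψ)
    (h0 : μ (Set.range ψ) ≠ 0) :
    ∃ K : Set (ℕ → ℕ), IsCompact K ∧ μ (ψ '' K) ≠ 0 := by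
  obtain ⟨c, hc0, hc⟩ := exists_between (pos_iff_ne_zero.2 h0)
  let P : Set (ℕ → ℕ) → Prop := fun S => c < μ (ψ '' S)
  have step : ∀ (n : ℕ) (S : Set (ℕ → ℕ)), P S → ∃ m : ℕ, P (S ∩ {x | x n ≤ m}) := by
    intro n S hS
    have hU : ψ '' S = ⋃ m : ℕ, ψ '' (S ∩ {x | x n ≤ m}) := by
      rw [← Set.image_iUnion, ← Set.inter_iUnion]
      congr 1
      ext x
      simp only [Set.mem_inter_iff, Set.mem_iUnion, Set.mem_setOf_eq]
      exact ⟨fun h => ⟨h, x n, le_rfl⟩, fun h => h.1⟩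
    have hm : Monotone fun m : ℕ => ψ '' (S ∩ {x | x n ≤ m}) := by
      intro a b hab
      refine Set.image_mono (Set.inter_subset_inter_right _ ?_)
      intro x hx
      exact le_trans hx hab
    have hS' : c < μ (ψ '' S) := hS
    rw [hU, hm.measure_iUnion, lt_iSup_iff] at hS'
    exact hS'
  choose! f hf using step
  let T : ℕ → Set (ℕ → ℕ) := fun n =>
    Nat.rec Set.univ (fun n S => S ∩ {x | x n ≤ f n S}) n
  have hT : ∀ n, P (T n) := by
    intro n
    induction n with
    | zero => simpa [T, P] using hc
    | succ n ih => exact hf n _ ih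
  let s : ℕ → ℕ := fun n => f n (T n)
  have hTs : ∀ n, T n = {x : ℕ → ℕ | ∀ i < n, x i ≤ s i} := by
    intro n
    induction n with
    | zero => simp [T]
    | succ n ih =>
      have : T (n + 1) = T n ∩ {x | x n ≤ s n} := rfl
      rw [this, ih]
      ext x
      simp only [Set.mem_inter_iff, Set.mem_setOf_eq, Nat.lt_succ_iff_lt_or_eq, or_imp, forall_and, forall_eq]
  refine ⟨{x : ℕ → ℕ | ∀ i, x i ≤ s i}, ?_, ?_⟩
  · have h := isCompact_univ_pi (X := fun _ : ℕ => ℕ) (s := fun i => Set.Iic (s i))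
      (fun i => (Set.finite_Iic (s i)).isCompact)
    convert h using 1
    ext x; simp [Pi.le_def]
  · intro hz
    obtain ⟨U, hKU, hUo, hU⟩ := Set.exists_isOpen_lt_of_lt (μ := μ) _ c (hz ▸ hc0)
    obtain ⟨n, hn⟩ := aux_compact_tube s (ψ ⁻¹' U) (hUo.preimage hψ) (Set.image_subset_iff.1 hKU)
    rw [← hTs n] at hn
    have h1 : c < μ (ψ '' T n) := hT n
    exact absurd (h1.trans_le (measure_mono (Set.image_subset_iff.2 hn))) (not_lt.2 hU.le)

/-- If the image under `f` of a Borel set `A` is non-null, then there are Borel sets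
`T ⊆ g '' A` and `B` non-null with `B` lying below `T`. -/
theorem aux_select {X Y Z : Type*} [MeasurableSpace X] [StandardBorelSpace X]
    [MeasurableSpace Y] [StandardBorelSpace Y] [MeasurableSpace Z] [StandardBorelSpace Z]
    (μ : Measure X) [SigmaFinite μ] (h : Y → X) (hh : Measurable h) (g : Z → Y)
    (hg : Measurable g) (A : Set Z) (hA : MeasurableSet A) (h0 : μ (h '' (g '' A)) ≠ 0) :
    ∃ (T : Set Y) (B : Set X), MeasurableSet T ∧ MeasurableSet B ∧ T ⊆ g '' A ∧ B ⊆ h '' T ∧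
      μ B ≠ 0 := by
  letI := upgradeStandardBorel X
  letI := upgradeStandardBorel Y
  have han : AnalyticSet ((fun z => (h (g z), g z)) '' A) :=
    hA.analyticSet_image ((hh.comp hg).prodMk hg)
  rw [AnalyticSet] at han
  rcases han with he | ⟨φ, hφ, hr⟩
  · rw [Set.image_eq_empty] at he
    simp [he] at h0
  have hmem : ∀ x, ∃ z ∈ A, (h (g z), g z) = φ x := by
    intro x
    have : φ x ∈ Set.range φ := ⟨x, rfl⟩
    rwa [hr] at this
  have hrange : Set.range (fun x => (φ x).1) = h '' (g '' A) := by
    have : Set.range (fun x => (φ x).1) = Prod.fst '' Set.range φ := by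
      rw [← Set.range_comp]; rfl
    rw [this, hr, Set.image_image, Set.image_image]
  obtain ⟨K, hK, hK0⟩ := aux_capacity μ.toFinite (fun x => (φ x).1) (continuous_fst.comp hφ)
    (by
      rw [hrange]
      exact fun hz => h0 (absolutelyContinuous_toFinite μ hz))
  refine ⟨(fun x => (φ x).2) '' K, (fun x => (φ x).1) '' K,
    (hK.image (continuous_snd.comp hφ)).measurableSet,
    (hK.image (continuous_fst.comp hφ)).measurableSet, ?_, ?_,
    fun hz => hK0 (toFinite_absolutelyContinuous μ hz)⟩
  · rintro _ ⟨x, -, rfl⟩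
    obtain ⟨z, hz, hzx⟩ := hmem x
    exact ⟨z, hz, by simp [← hzx]⟩
  · rintro _ ⟨x, hx, rfl⟩
    obtain ⟨z, hz, hzx⟩ := hmem x
    exact ⟨(φ x).2, ⟨x, hx, rfl⟩, by simp [← hzx]⟩

theorem aux_nuL_ge {Y : Type*} [MeasurableSpace Y] (μ : Measure Y) (A : Set (Y × Y)) (T : Set Y)
    (hT : MeasurableSet T) (hTA : T ⊆ Prod.fst '' A) : μ T ≤ nuL μ A := by
  rw [← lintegral_indicator_one hT]
  refine lintegral_mono fun x => ?_
  by_cases hx : x ∈ T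
  · obtain ⟨⟨a, b⟩, hab, rfl⟩ := hTA hx
    rw [Set.indicator_of_mem hx]
    exact ENNReal.le_tsum (f := fun _ : {y : Y // (a, y) ∈ A} => (1 : ℝ≥0∞)) ⟨b, hab⟩
  · rw [Set.indicator_of_notMem hx]; exact zero_le

theorem aux_nuL_zero {Y : Type*} [MeasurableSpace Y] (μ : Measure Y) (A : Set (Y × Y))
    (h : μ (Prod.fst '' A) = 0) : nuL μ A = 0 := by
  unfold nuL lintL
  rw [← lintegral_zero (μ := μ)]
  refine lintegral_congr_ae ?_
  have h' : ∀ᵐ x ∂μ, x ∉ Prod.fst '' A := measure_eq_zero_iff_ae_notMem.1 h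
  filter_upwards [h'] with x hx
  have : IsEmpty {y : Y // (x, y) ∈ A} := ⟨fun y => hx ⟨(x, y), y.2, rfl⟩⟩
  exact tsum_empty

theorem aux_nuR_eq {Y : Type*} [MeasurableSpace Y] (μ : Measure Y) (A : Set (Y × Y)) :
    nuR μ A = nuL μ (Prod.swap ⁻¹' A) := rfl

theorem aux_fst_swap {Y : Type*} (A : Set (Y × Y)) :
    Prod.fst '' (Prod.swap ⁻¹' A) = Prod.snd '' A := by
  ext x; simp [Pi.le_def]

theorem aux_nuL_proj {X Y : Type*} [MeasurableSpace X] [StandardBorelSpace X]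
    [MeasurableSpace Y] [StandardBorelSpace Y] (μ : Measure X) [SigmaFinite μ] (ν : Measure Y)
    (h : Y → X) (hh : Measurable h)
    (H : ∀ (T : Set Y) (B : Set X), MeasurableSet T → MeasurableSet B → B ⊆ h '' T →
      ν T = 0 → μ B = 0)
    (A : Set (Y × Y)) (hA : MeasurableSet A) (h0 : nuL ν A = 0) :
    μ (h '' (Prod.fst '' A)) = 0 := by
  by_contra hne
  obtain ⟨T, B, hT, hB, hTA, hBT, hB0⟩ := aux_select μ h hh Prod.fst measurable_fst A hA hne
  refine hB0 (H T B hT hB hBT ?_)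
  exact le_antisymm ((aux_nuL_ge ν A T hT hTA).trans h0.le) (zero_le)

theorem aux_mcp {X : Type*} [MeasurableSpace X] [StandardBorelSpace X]
    (μ : Measure X) [SigmaFinite μ] (F : Set (X × X)) (hF : IsCBER F) (h : MCP μ F)
    (N : Set X) (hN : μ N = 0) : μ {y | ∃ x ∈ N, (x, y) ∈ F} = 0 := by
  let M := toMeasurable μ N
  have hM : MeasurableSet M := measurableSet_toMeasurable _ _
  have hM0 : μ M = 0 := by rw [measure_toMeasurable, hN]
  let A : Set (X × X) := F ∩ Prod.fst ⁻¹' M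
  have hA : MeasurableSet A := hF.1.inter (measurable_fst hM)
  have h1 : nuL μ A = 0 := by
    refine aux_nuL_zero μ A (measure_mono_null ?_ hM0)
    rintro _ ⟨a, ha, rfl⟩
    exact ha.2
  have h2 := (h A Set.inter_subset_left hA).1 h1
  rw [aux_nuR_eq] at h2
  have h3 := aux_nuL_proj μ μ id measurable_id
    (fun T B _ _ hBT hT0 => measure_mono_null (by simpa using hBT) hT0)
    _ (measurable_swap hA) h2
  rw [aux_fst_swap, Set.image_id] at h3
  refine measure_mono_null ?_ h3
  rintro y ⟨x, hx, hxy⟩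
  exact ⟨(x, y), ⟨hxy, subset_toMeasurable _ _ hx⟩, rfl⟩

theorem aux_nuL_diag {X : Type*} [MeasurableSpace X] (μ : Measure X) (A : Set X)
    (hA : MeasurableSet A) : nuL μ ((fun x => (x, x)) '' A) = μ A := by
  refine le_antisymm ?_ (aux_nuL_ge μ _ A hA fun x hx => ⟨(x, x), ⟨x, hx, rfl⟩, rfl⟩)
  rw [← lintegral_indicator_one hA]
  refine lintegral_mono fun x => ?_
  by_cases hx : x ∈ A
  · rw [Set.indicator_of_mem hx]
    have hs : ∀ y : {y : X // (x, y) ∈ (fun x => (x, x)) '' A}, y = ⟨x, ⟨x, hx, rfl⟩⟩ := by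
      rintro ⟨y, ⟨z, hz, hzy⟩⟩
      simp only [Prod.mk.injEq] at hzy
      exact Subtype.ext (hzy.2.symm.trans hzy.1)
    show ∑' y : {y : X // (x, y) ∈ (fun x => (x, x)) '' A}, (1 : ℝ≥0∞) ≤ 1
    rw [tsum_eq_single ⟨x, ⟨x, hx, rfl⟩⟩ (fun y hy => absurd (hs y) hy)]
  · rw [Set.indicator_of_notMem hx]
    have : IsEmpty {y : X // (x, y) ∈ (fun x => (x, x)) '' A} := by
      refine ⟨fun y => ?_⟩
      obtain ⟨y, ⟨z, hz, hzy⟩⟩ := y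
      simp only [Prod.mk.injEq] at hzy
      exact hx (hzy.1 ▸ hz)
    exact tsum_empty.le

/-- Let `(X, μ, E)` be an mcp CBER and `F ⊆ E` a properly ergodic mcp type
III subrelation. On the space `(E, ν_l)` define `e F⁽²⁾ e' ↔ s(e) F s(e')`. Then
`(E, ν_l, F⁽²⁾)` is an mcp, ergodic, type III CBER. Here `ν` is any measure on `E` agreeing
with the set function `ν_l` (computed from `μ`) on Borel sets. -/
theorem fiberwise_relation_typeIII {X : Type*} [MeasurableSpace X] [StandardBorelSpace X]
    (μ : Measure X) [SigmaFinite μ]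
    (E F : Set (X × X)) (hE : IsCBER E) (hmcpE : MCP μ E)
    (hFE : F ⊆ E) (hF : IsCBER F) (hmcpF : MCP μ F)
    (hpeF : ProperlyErgodicRel μ F) (hIIIF : IsTypeIII μ F)
    (ν : Measure ↥E)
    (hν : ∀ S : Set ↥E, MeasurableSet S → ν S = nuL μ (Subtype.val '' S)) :
    IsCBER {p : ↥E × ↥E | ((p.1 : X × X).1, (p.2 : X × X).1) ∈ F} ∧
    MCP ν {p : ↥E × ↥E | ((p.1 : X × X).1, (p.2 : X × X).1) ∈ F} ∧
    ErgodicRel ν {p : ↥E × ↥E | ((p.1 : X × X).1, (p.2 : X × X).1) ∈ F} ∧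
    IsTypeIII ν {p : ↥E × ↥E | ((p.1 : X × X).1, (p.2 : X × X).1) ∈ F} := by
  haveI : StandardBorelSpace ↥E := hE.1.standardBorel
  obtain ⟨hEm, hEe, hEc⟩ := hE
  have hF' := hF
  obtain ⟨hFm, hFe, hFc⟩ := hF'
  let s : ↥E → X := fun e => (e : X × X).1
  have hs : Measurable s := measurable_fst.comp measurable_subtype_coe
  -- `ν` and projections
  have hH : ∀ (T : Set ↥E) (B : Set X), MeasurableSet T → MeasurableSet B → B ⊆ s '' T →
      ν T = 0 → μ B = 0 := by
    intro T B hT hB hBT hT0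
    rw [hν T hT] at hT0
    refine le_antisymm ((aux_nuL_ge μ _ B hB ?_).trans hT0.le) (zero_le)
    rw [Set.image_image]
    exact hBT
  have hpre : ∀ N : Set X, μ N = 0 → ν (s ⁻¹' N) = 0 := by
    intro N hN
    have hM : MeasurableSet (toMeasurable μ N) := measurableSet_toMeasurable _ _
    refine measure_mono_null (Set.preimage_mono (subset_toMeasurable μ N)) ?_
    rw [hν _ (hs hM)]
    refine aux_nuL_zero μ _ (measure_mono_null ?_ ((measure_toMeasurable N).trans hN))
    rw [Set.image_image]
    rintro _ ⟨e, he, rfl⟩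
    exact he
  have hR : MeasurableSet {p : ↥E × ↥E | ((p.1 : X × X).1, (p.2 : X × X).1) ∈ F} :=
    ((hs.comp measurable_fst).prodMk (hs.comp measurable_snd)) hFm
  have key : ∀ A : Set (↥E × ↥E),
      A ⊆ {p : ↥E × ↥E | ((p.1 : X × X).1, (p.2 : X × X).1) ∈ F} → MeasurableSet A →
      nuL ν A = 0 → nuR ν A = 0 := by
    intro A hAF hA h0
    have h1 := aux_mcp μ F hF hmcpF _ (aux_nuL_proj μ ν s hs hH A hA h0)
    rw [aux_nuR_eq]
    refine aux_nuL_zero ν _ (measure_mono_null ?_ (hpre _ h1))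
    rw [aux_fst_swap]
    rintro _ ⟨p, hp, rfl⟩
    exact ⟨s p.1, ⟨p.1, ⟨p, hp, rfl⟩, rfl⟩, hAF hp⟩
  refine ⟨⟨hR, ⟨fun e => hFe.refl _, fun h => hFe.symm h, fun h h' => hFe.trans h h'⟩, ?_⟩,
    ?_, ?_, ?_⟩
  · intro e
    have hc : (⋃ x ∈ {x | (s e, x) ∈ F}, Prod.mk x '' {y | (x, y) ∈ E}).Countable :=
      (hFc (s e)).biUnion fun x _ => (hEc x).image _
    refine (hc.preimage_of_injOn (f := (Subtype.val : ↥E → X × X))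
      Subtype.val_injective.injOn).mono ?_
    intro e' he'
    simp only [Set.mem_preimage, Set.mem_iUnion]
    exact ⟨e'.1.1, he', e'.1.2, e'.2, rfl⟩
  · intro A hAF hA
    refine ⟨key A hAF hA, fun h => ?_⟩
    have := key (Prod.swap ⁻¹' A) (fun p hp => hFe.symm (hAF hp)) (measurable_swap hA) h
    exact this
  · intro S hS hS0
    have hne : μ (s '' (id '' S)) ≠ 0 := by
      intro hz
      rw [Set.image_id] at hz
      exact hS0 (measure_mono_null (Set.subset_preimage_image s S) (hpre _ hz))
    obtain ⟨T, B, hT, hB, hTS, hBT, hB0⟩ := aux_select μ s hs id measurable_id S hS hne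
    rw [Set.image_id] at hTS
    refine measure_mono_null ?_ (hpre _ (hpeF.1 B hB hB0))
    intro e he hmem
    obtain ⟨x, hx, hxF⟩ := hmem
    obtain ⟨t, ht, rfl⟩ := hBT hx
    exact he ⟨t, hTS ht, hxF⟩
  · rintro ⟨ν', hσ, ⟨hac1, hac2⟩, hinv⟩
    let d : X → ↥E := fun x => ⟨(x, x), hEe.refl x⟩
    have hd : Measurable d := (measurable_id.prodMk measurable_id).subtype_mk
    have hdi : Function.Injective d := fun x y hxy => congrArg s hxy
    have hde : MeasurableEmbedding d := hd.measurableEmbedding hdi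
    have hνd : ∀ A, MeasurableSet A → ν (d '' A) = μ A := by
      intro A hA
      rw [hν _ (hde.measurableSet_image' hA), Set.image_image]
      exact aux_nuL_diag μ A hA
    have hco : ∀ A, ν'.comap d A = ν' (d '' A) := fun A => hde.comap_apply _ _
    have hsf : SigmaFinite (ν'.comap d) := by
      refine SigmaFinite.of_map _ hd.aemeasurable ?_
      rw [hde.map_comap]
      infer_instance
    refine hIIIF ⟨ν'.comap d, hsf, ⟨?_, ?_⟩, ?_⟩
    · refine Measure.AbsolutelyContinuous.mk fun A hA h0 => ?_
      rw [hco]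
      exact hac1 ((hνd A hA).trans h0)
    · refine Measure.AbsolutelyContinuous.mk fun A hA h0 => ?_
      rw [hco] at h0
      rw [← hνd A hA]
      exact hac2 h0
    · intro f A hf hA hinj hfF
      have hi := hinv (fun e => d (f (s e))) (d '' A) (hd.comp (hf.comp hs))
        (hde.measurableSet_image' hA) ?_ ?_
      · have hfA : MeasurableSet (f '' A) := hA.image_of_measurable_injOn hf hinj
        ext B hB
        have hB' := congrArg (fun m => m (d '' B)) hi
        have hdB : MeasurableSet (d '' B) := hde.measurableSet_image' hB
        have hg : Measurable (fun e => d (f (s e))) := hd.comp (hf.comp hs)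
        rw [Measure.map_apply hg hdB, Measure.restrict_apply (hg hdB),
          Measure.restrict_apply hdB] at hB'
        rw [Measure.map_apply hf hB, Measure.restrict_apply (hf hB), Measure.restrict_apply hB,
          hco, hco]
        convert hB' using 2
        · ext e
          constructor
          · rintro ⟨x, ⟨hxB, hxA⟩, rfl⟩
            exact ⟨⟨f x, hxB, rfl⟩, ⟨x, hxA, rfl⟩⟩
          · rintro ⟨⟨y, hy, hye⟩, ⟨x, hx, rfl⟩⟩
            have : y = f x := hdi hye
            subst this
            exact ⟨x, ⟨hy, hx⟩, rfl⟩
        · rw [Set.image_image, Set.image_inter hdi, Set.image_image]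
      · rintro _ ⟨x, hx, rfl⟩ _ ⟨y, hy, rfl⟩ hxy
        exact congrArg d (hinj hx hy (hdi hxy))
      · rintro _ ⟨x, hx, rfl⟩
        exact hfF x hx
end
end
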